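/- arXiv:0907.4684 — 2 statements merged into one kernel-verified Lean document; each statement's English description precedes it below -/
import Mathlib

section
/- For the dynamical system given by the von Neumann–Kakutani map T on [0,1] with Lebesgue measure λ, the return time generalized dimensions take the values D_τ^+(q) = D_τ^-(q) = 1 for all q ≤ 2 (q ≠ 1 in the power-law definition), and D_τ^+(q) = D_τ^-(q) = 1/(q−1) for all q > 2. -/
open MeasureTheory Filter Set
open scoped ENNReal Topology NNReal

noncomputable section

/-- First return time of `x` to the set `A` under the map `T`;
by convention it is `0` if the orbit of `x` never returns to `A`. -/
def firstReturn {α : Type*} (T : α → α) (A : Set α) (x : α) : ℕ :=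
  sInf {k : ℕ | 0 < k ∧ T^[k] x ∈ A}

/-- Extended logarithm `ℝ≥0∞ → EReal`. -/
def elog (x : ℝ≥0∞) : EReal :=
  if x = 0 then ⊥ else if x = ⊤ then ⊤ else ((Real.log x.toReal : ℝ) : EReal)

section Generic

variable {α : Type*} [MeasurableSpace α] [PseudoMetricSpace α]

/-- The measure partition function `Γ_μ(ε,q)`. -/
def measPF (μ : Measure α) (ε q : ℝ) : ℝ≥0∞ :=
  ∫⁻ x, μ (Metric.ball x ε) ^ (q - 1) ∂μ

/-- The logarithmic measure partition function `Γ^l_μ(ε)`. -/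
def measPFlog (μ : Measure α) (ε : ℝ) : ℝ :=
  ∫ x, Real.log (μ (Metric.ball x ε)).toReal ∂μ

/-- The return time partition function `Γ_τ(ε,q)`. -/
def retPF (T : α → α) (μ : Measure α) (ε q : ℝ) : ℝ≥0∞ :=
  ∫⁻ x, (firstReturn T (Metric.ball x ε) x : ℝ≥0∞) ^ (1 - q) ∂μ

/-- The logarithmic return time partition function `Γ^l_τ(ε)`. -/
def retPFlog (T : α → α) (μ : Measure α) (ε : ℝ) : ℝ :=
  ∫ x, Real.log ((firstReturn T (Metric.ball x ε) x : ℝ))⁻¹ ∂μ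

/-- The scaling exponent `(1/(q-1)) · log F(ε) / log ε`. -/
def dimScale (F : ℝ → ℝ≥0∞) (q : ℝ) (ε : ℝ) : EReal :=
  ((((q - 1) * Real.log ε)⁻¹ : ℝ) : EReal) * elog (F ε)

/-- Upper generalized dimension obtained from a one-parameter family of partition
functions `F ε`, with the logarithmic convention at `q = 1`. -/
def dimPlus (F : ℝ → ℝ≥0∞) (Flog : ℝ → ℝ) (q : ℝ) : EReal :=
  if q = 1 then ((limsup (fun ε => Flog ε / Real.log ε) (𝓝[>] (0:ℝ)) : ℝ) : EReal)
  else limsup (dimScale F q) (𝓝[>] (0:ℝ))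

/-- Lower generalized dimension. -/
def dimMinus (F : ℝ → ℝ≥0∞) (Flog : ℝ → ℝ) (q : ℝ) : EReal :=
  if q = 1 then ((liminf (fun ε => Flog ε / Real.log ε) (𝓝[>] (0:ℝ)) : ℝ) : EReal)
  else liminf (dimScale F q) (𝓝[>] (0:ℝ))

/-- Generalized measure dimensions `D_μ^+(q)`. -/
def DmuPlus (μ : Measure α) (q : ℝ) : EReal :=
  dimPlus (fun ε => measPF μ ε q) (measPFlog μ) q

/-- Generalized measure dimensions `D_μ^-(q)`. -/
def DmuMinus (μ : Measure α) (q : ℝ) : EReal :=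
  dimMinus (fun ε => measPF μ ε q) (measPFlog μ) q

/-- Return time generalized dimensions `D_τ^+(q)`. -/
def DtauPlus (T : α → α) (μ : Measure α) (q : ℝ) : EReal :=
  dimPlus (fun ε => retPF T μ ε q) (retPFlog T μ) q

/-- Return time generalized dimensions `D_τ^-(q)`. -/
def DtauMinus (T : α → α) (μ : Measure α) (q : ℝ) : EReal :=
  dimMinus (fun ε => retPF T μ ε q) (retPFlog T μ) q

end Generic

/-- Euclidean space `ℝ^n`. -/
abbrev Euc (n : ℕ) := EuclideanSpace ℝ (Fin n)

/-- A grid in `ℝ^n` : a choice of origin and orientation, determining for every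
side length `ε` a partition of `ℝ^n` into half-open cubes of side `ε`. -/
structure Grid (n : ℕ) where
  origin : Euc n
  rot : Euc n ≃ₗᵢ[ℝ] Euc n

/-- Coordinates of a point w.r.t. a grid. -/
def Grid.coords {n : ℕ} (θ : Grid n) (x : Euc n) : Fin n → ℝ :=
  fun i => θ.rot.symm (x - θ.origin) i

/-- The cube `A_j` of side `ε` of the grid `θ`, indexed by `j : Fin n → ℤ`. -/
def Grid.box {n : ℕ} (θ : Grid n) (ε : ℝ) (j : Fin n → ℤ) : Set (Euc n) :=
  {x | ∀ i, (j i : ℝ) * ε ≤ θ.coords x i ∧ θ.coords x i < ((j i : ℝ) + 1) * ε}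

/-- The enlarged cube `Ā_j` of side `3ε` concentric with `A_j`. -/
def Grid.bigBox {n : ℕ} (θ : Grid n) (ε : ℝ) (j : Fin n → ℤ) : Set (Euc n) :=
  {x | ∀ i, ((j i : ℝ) - 1) * ε ≤ θ.coords x i ∧ θ.coords x i < ((j i : ℝ) + 2) * ε}

/-- Box measure partition function `Υ_μ(θ,ε,q) = Σ_{μ(A_j)>0} μ(A_j)^q`. -/
def boxMeasPF {n : ℕ} (μ : Measure (Euc n)) (θ : Grid n) (ε q : ℝ) : ℝ≥0∞ :=
  ∑' j : Fin n → ℤ, if μ (θ.box ε j) = 0 then 0 else μ (θ.box ε j) ^ q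

/-- Logarithmic box measure partition function `Υ^l_μ(θ,ε)`. -/
def boxMeasPFlog {n : ℕ} (μ : Measure (Euc n)) (θ : Grid n) (ε : ℝ) : ℝ :=
  ∑' j : Fin n → ℤ, (μ (θ.box ε j)).toReal * Real.log (μ (θ.box ε j)).toReal

/-- Return time box partition function `Υ_τ(θ,ε,q)`. -/
def boxRetPF {n : ℕ} (T : Euc n → Euc n) (μ : Measure (Euc n)) (θ : Grid n)
    (ε q : ℝ) : ℝ≥0∞ :=
  ∑' j : Fin n → ℤ, ∫⁻ x in θ.box ε j,
    (firstReturn T (θ.box ε j) x : ℝ≥0∞) ^ (1 - q) ∂μ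

/-- Logarithmic return time box partition function `Υ^l_τ(θ,ε)`. -/
def boxRetPFlog {n : ℕ} (T : Euc n → Euc n) (μ : Measure (Euc n)) (θ : Grid n)
    (ε : ℝ) : ℝ :=
  ∑' j : Fin n → ℤ, ∫ x in θ.box ε j,
    Real.log ((firstReturn T (θ.box ε j) x : ℝ))⁻¹ ∂μ

/-- Riedi's enhanced box partition function `Φ_μ(θ,ε,q)`. -/
def riediPF {n : ℕ} (μ : Measure (Euc n)) (θ : Grid n) (ε q : ℝ) : ℝ≥0∞ :=
  ∑' j : Fin n → ℤ, if μ (θ.box ε j) = 0 then 0 else μ (θ.bigBox ε j) ^ q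

/-- The enhanced box partition function `Ψ_μ(θ,ε,q) = Σ_{μ(A_j)>0} μ(A_j) μ(Ā_j)^{q-1}`. -/
def psiMeasPF {n : ℕ} (μ : Measure (Euc n)) (θ : Grid n) (ε q : ℝ) : ℝ≥0∞ :=
  ∑' j : Fin n → ℤ,
    if μ (θ.box ε j) = 0 then 0 else μ (θ.box ε j) * μ (θ.bigBox ε j) ^ (q - 1)

/-- The logarithmic enhanced box partition function `Ψ^l_μ(θ,ε)`. -/
def psiMeasPFlog {n : ℕ} (μ : Measure (Euc n)) (θ : Grid n) (ε : ℝ) : ℝ :=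
  ∑' j : Fin n → ℤ, (μ (θ.box ε j)).toReal * Real.log (μ (θ.bigBox ε j)).toReal

/-- The enhanced return time box partition function `Ψ_τ(θ,ε,q)`:
the integral is over `A_j` but the return is to the enlarged box `Ā_j`. -/
def psiRetPF {n : ℕ} (T : Euc n → Euc n) (μ : Measure (Euc n)) (θ : Grid n)
    (ε q : ℝ) : ℝ≥0∞ :=
  ∑' j : Fin n → ℤ, ∫⁻ x in θ.box ε j,
    (firstReturn T (θ.bigBox ε j) x : ℝ≥0∞) ^ (1 - q) ∂μ

/-- Box measure dimensions `Δ_μ^+(θ,q)`. -/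
def DeltaMuPlus {n : ℕ} (μ : Measure (Euc n)) (θ : Grid n) (q : ℝ) : EReal :=
  dimPlus (fun ε => boxMeasPF μ θ ε q) (boxMeasPFlog μ θ) q

/-- Box measure dimensions `Δ_μ^-(θ,q)`. -/
def DeltaMuMinus {n : ℕ} (μ : Measure (Euc n)) (θ : Grid n) (q : ℝ) : EReal :=
  dimMinus (fun ε => boxMeasPF μ θ ε q) (boxMeasPFlog μ θ) q

/-- Box return time dimensions `Δ_τ^+(θ,q)`. -/
def DeltaTauPlus {n : ℕ} (T : Euc n → Euc n) (μ : Measure (Euc n)) (θ : Grid n)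
    (q : ℝ) : EReal :=
  dimPlus (fun ε => boxRetPF T μ θ ε q) (boxRetPFlog T μ θ) q

/-- Box return time dimensions `Δ_τ^-(θ,q)`. -/
def DeltaTauMinus {n : ℕ} (T : Euc n → Euc n) (μ : Measure (Euc n)) (θ : Grid n)
    (q : ℝ) : EReal :=
  dimMinus (fun ε => boxRetPF T μ θ ε q) (boxRetPFlog T μ θ) q

end

/-- The self-similarity relations of the von Neumann–Kakutani map on `[0,1)`. -/
structure IsDyadicOdometer (T : ℝ → ℝ) : Prop where
  mapsTo : MapsTo T (Ico 0 1) (Ico 0 1)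
  left_half : ∀ y ∈ Ico (0:ℝ) 1, T (y / 2) = (1 + y) / 2
  right_half : ∀ y ∈ Ico (0:ℝ) 1, T ((1 + y) / 2) = T y / 2

theorem exists_mem_Ico_one_sub_two_zpow {x : ℝ} (hx : x ∈ Ico (0:ℝ) 1) :
    ∃ k : ℕ, x ∈ Ico (1 - (2:ℝ) ^ (-(k:ℤ))) (1 - (2:ℝ) ^ (-(k:ℤ) - 1)) := by
  obtain ⟨k, h1, h2⟩ := exists_nat_pow_near_of_lt_one (x := 1 - x) (y := (1/2:ℝ))
    (by linarith [hx.2]) (by linarith [hx.1]) (by norm_num) (by norm_num)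
  refine ⟨k, ?_, ?_⟩
  · have : (2:ℝ) ^ (-(k:ℤ)) = (1/2)^k := by simp
    rw [this]; linarith
  · have : (2:ℝ) ^ (-(k:ℤ) - 1) = (1/2)^(k+1) := by
      rw [zpow_sub₀ (by norm_num)]; simp [pow_succ]; ring
    rw [this]; linarith

theorem isDyadicOdometer_of_piecewise {T : ℝ → ℝ}
    (hT : ∀ k : ℕ, ∀ x ∈ Set.Ico (1 - (2:ℝ) ^ (-(k:ℤ))) (1 - (2:ℝ) ^ (-(k:ℤ) - 1)),
      T x = x - 1 + (2:ℝ) ^ (-(k:ℤ)) + (2:ℝ) ^ (-(k:ℤ) - 1)) :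
    IsDyadicOdometer T := by
  have half (k : ℤ) : (2:ℝ) ^ (k - 1) = 2 ^ k / 2 := by
    rw [zpow_sub₀ (by norm_num)]; simp
  refine ⟨fun x hx => ?_, fun y hy => ?_, fun y hy => ?_⟩
  · obtain ⟨k, hk⟩ := exists_mem_Ico_one_sub_two_zpow hx
    rw [hT k x hk]
    rw [half] at hk ⊢
    have h0 : (0:ℝ) < 2 ^ (-(k:ℤ)) := by positivity
    have h1 : (2:ℝ) ^ (-(k:ℤ)) ≤ 1 := zpow_le_one_of_nonpos₀ (by norm_num) (by simp)
    constructor <;> linarith [hk.1, hk.2]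
  · have h := hT 0 (y / 2) (by
      rw [half]; simp only [Nat.cast_zero, neg_zero, zpow_zero]
      constructor <;> linarith [hy.1, hy.2])
    rw [h, half]; simp only [Nat.cast_zero, neg_zero, zpow_zero]; ring
  · obtain ⟨k, hk⟩ := exists_mem_Ico_one_sub_two_zpow hy
    have e : (2:ℝ) ^ (-((k + 1 : ℕ):ℤ)) = 2 ^ (-(k:ℤ)) / 2 := by
      rw [← half]; congr 1; push_cast; ring
    rw [hT k y hk, hT (k + 1) ((1 + y) / 2), half, half, e]
    · ring
    · rw [half, e]; rw [half] at hk
      constructor <;> linarith [hk.1, hk.2]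

namespace IsDyadicOdometer

theorem iterate_mem {T : ℝ → ℝ} (hT : IsDyadicOdometer T) {x : ℝ} (hx : x ∈ Ico (0:ℝ) 1)
    (k : ℕ) : T^[k] x ∈ Ico (0:ℝ) 1 :=
  hT.mapsTo.iterate k hx

theorem iterate_two_mul_left {T : ℝ → ℝ} (hT : IsDyadicOdometer T) {y : ℝ}
    (hy : y ∈ Ico (0:ℝ) 1) (k : ℕ) : T^[2 * k] (y / 2) = T^[k] y / 2 := by
  induction k with
  | zero => simp
  | succ k ih =>
    have h := hT.iterate_mem hy k
    rw [show 2 * (k + 1) = 2 * k + 1 + 1 by ring, Function.iterate_succ_apply',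
      Function.iterate_succ_apply', ih, hT.left_half _ h, hT.right_half _ h,
      Function.iterate_succ_apply']

theorem iterate_two_mul_add_one_left {T : ℝ → ℝ} (hT : IsDyadicOdometer T) {y : ℝ}
    (hy : y ∈ Ico (0:ℝ) 1) (k : ℕ) : T^[2 * k + 1] (y / 2) = (1 + T^[k] y) / 2 := by
  rw [Function.iterate_succ_apply', hT.iterate_two_mul_left hy,
    hT.left_half _ (hT.iterate_mem hy k)]

theorem iterate_two_mul_add_one_right {T : ℝ → ℝ} (hT : IsDyadicOdometer T) {y : ℝ}
    (hy : y ∈ Ico (0:ℝ) 1) (k : ℕ) : T^[2 * k + 1] ((1 + y) / 2) = T^[k + 1] y / 2 := by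
  rw [Function.iterate_succ_apply, hT.right_half _ hy,
    hT.iterate_two_mul_left (hT.mapsTo hy), Function.iterate_succ_apply]

theorem iterate_two_mul_right {T : ℝ → ℝ} (hT : IsDyadicOdometer T) {y : ℝ}
    (hy : y ∈ Ico (0:ℝ) 1) (k : ℕ) : T^[2 * k] ((1 + y) / 2) = (1 + T^[k] y) / 2 := by
  rw [← hT.left_half y hy, ← Function.iterate_succ_apply, hT.iterate_two_mul_add_one_left hy]

theorem exists_half {x : ℝ} (hx : x ∈ Ico (0:ℝ) 1) :
    ∃ y ∈ Ico (0:ℝ) 1, x = y / 2 ∨ x = (1 + y) / 2 := by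
  rcases lt_or_ge x (1/2) with h | h
  · exact ⟨2 * x, ⟨by linarith [hx.1], by linarith⟩, Or.inl (by ring)⟩
  · exact ⟨2 * x - 1, ⟨by linarith, by linarith [hx.2]⟩, Or.inr (by ring)⟩

theorem floor_two_pow_succ_mul_left (M : ℕ) (y : ℝ) :
    ⌊(2:ℝ) ^ (M + 1) * (y / 2)⌋ = ⌊(2:ℝ) ^ M * y⌋ := by
  congr 1; ring

theorem floor_two_pow_succ_mul_right (M : ℕ) (y : ℝ) :
    ⌊(2:ℝ) ^ (M + 1) * ((1 + y) / 2)⌋ = ⌊(2:ℝ) ^ M * y⌋ + 2 ^ M := by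
  rw [← Int.floor_add_intCast]
  congr 1; push_cast; ring

theorem floor_two_pow_mul_mem (M : ℕ) {y : ℝ} (hy : y ∈ Ico (0:ℝ) 1) :
    0 ≤ ⌊(2:ℝ) ^ M * y⌋ ∧ ⌊(2:ℝ) ^ M * y⌋ < 2 ^ M := by
  have hp : (0:ℝ) < 2 ^ M := by positivity
  refine ⟨Int.floor_nonneg.2 (mul_nonneg hp.le hy.1), ?_⟩
  rw [Int.floor_lt]; push_cast
  nlinarith [hy.2]

theorem two_pow_dvd_of_floor_eq {T : ℝ → ℝ} (hT : IsDyadicOdometer T) (M : ℕ) :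
    ∀ (k : ℕ) (x : ℝ), x ∈ Ico (0:ℝ) 1 → ⌊(2:ℝ) ^ M * T^[k] x⌋ = ⌊(2:ℝ) ^ M * x⌋ →
      2 ^ M ∣ k := by
  induction M with
  | zero => intro k x _ _; simp
  | succ M ih =>
    intro k x hx h
    obtain ⟨y, hy, hxy⟩ := exists_half hx
    have b0 := floor_two_pow_mul_mem M hy
    rcases Nat.even_or_odd' k with ⟨j, rfl | rfl⟩
    · rw [pow_succ, mul_comm]
      refine mul_dvd_mul_left 2 (ih j y hy ?_)
      rcases hxy with rfl | rfl
      · rwa [hT.iterate_two_mul_left hy, floor_two_pow_succ_mul_left,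
          floor_two_pow_succ_mul_left] at h
      · rw [hT.iterate_two_mul_right hy, floor_two_pow_succ_mul_right,
          floor_two_pow_succ_mul_right] at h
        linarith
    · exfalso
      rcases hxy with rfl | rfl
      · have b1 := floor_two_pow_mul_mem M (hT.iterate_mem hy j)
        rw [hT.iterate_two_mul_add_one_left hy, floor_two_pow_succ_mul_right,
          floor_two_pow_succ_mul_left] at h
        linarith
      · have b1 := floor_two_pow_mul_mem M (hT.iterate_mem hy (j + 1))
        rw [hT.iterate_two_mul_add_one_right hy, floor_two_pow_succ_mul_left,
          floor_two_pow_succ_mul_right] at h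
        linarith

theorem floor_iterate_two_pow {T : ℝ → ℝ} (hT : IsDyadicOdometer T) (M : ℕ) :
    ∀ x ∈ Ico (0:ℝ) 1, ⌊(2:ℝ) ^ M * T^[2 ^ M] x⌋ = ⌊(2:ℝ) ^ M * x⌋ := by
  induction M with
  | zero =>
    intro x hx
    have h1 := floor_two_pow_mul_mem 0 hx
    have h2 := floor_two_pow_mul_mem 0 (hT.iterate_mem hx (2 ^ 0))
    norm_num at h1 h2 ⊢
    linarith
  | succ M ih =>
    intro x hx
    obtain ⟨y, hy, rfl | rfl⟩ := exists_half hx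
    · rw [pow_succ' (2:ℕ), hT.iterate_two_mul_left hy, floor_two_pow_succ_mul_left,
        floor_two_pow_succ_mul_left, ih y hy]
    · rw [pow_succ' (2:ℕ), hT.iterate_two_mul_right hy, floor_two_pow_succ_mul_right,
        floor_two_pow_succ_mul_right, ih y hy]

theorem abs_iterate_two_pow_sub_lt {T : ℝ → ℝ} (hT : IsDyadicOdometer T) (M : ℕ) {x : ℝ}
    (hx : x ∈ Ico (0:ℝ) 1) : |T^[2 ^ M] x - x| < (1/2) ^ M := by
  have h := Int.abs_sub_lt_one_of_floor_eq_floor (hT.floor_iterate_two_pow M x hx)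
  rw [← mul_sub, abs_mul, abs_of_pos (by positivity : (0:ℝ) < 2 ^ M)] at h
  rw [one_div, inv_pow]
  rwa [← one_div, lt_div_iff₀' (by positivity)]

theorem apply_lt_of_near_one {T : ℝ → ℝ} (hT : IsDyadicOdometer T) (j : ℕ) :
    ∀ y ∈ Ico (0:ℝ) 1, 1 - (1/2) ^ j ≤ y → T y < (1/2) ^ j := by
  induction j with
  | zero => intro y hy _; simpa using (hT.mapsTo hy).2
  | succ j ih =>
    intro y hy h
    have hp : (1/2:ℝ) ^ j ≤ 1 := pow_le_one₀ (by norm_num) (by norm_num)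
    have e : (1/2:ℝ) ^ (j + 1) = (1/2) ^ j / 2 := by ring
    rw [e] at h ⊢
    have hz : 2 * y - 1 ∈ Ico (0:ℝ) 1 := ⟨by linarith, by linarith [hy.2]⟩
    have := ih _ hz (by linarith)
    have h2 := hT.right_half _ hz
    rw [show (1 + (2 * y - 1)) / 2 = y by ring] at h2
    rw [h2]; linarith

theorem abs_iterate_three_sub_lt {T : ℝ → ℝ} (hT : IsDyadicOdometer T) (j : ℕ) {x : ℝ}
    (hx : x ∈ Ico (1/2 - (1/2) ^ (j + 1)) (1/2:ℝ)) : |T^[3] x - x| < (1/2) ^ j := by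
  have e : (1/2:ℝ) ^ (j + 1) = (1/2) ^ j / 2 := by ring
  have hp : (1/2:ℝ) ^ j ≤ 1 := pow_le_one₀ (by norm_num) (by norm_num)
  rw [e] at hx
  have hy : 2 * x ∈ Ico (0:ℝ) 1 := ⟨by linarith [hx.1], by linarith [hx.2]⟩
  have h := hT.iterate_two_mul_add_one_left hy 1
  have h1 := hT.apply_lt_of_near_one j _ hy (by linarith [hx.1])
  have h2 := (hT.mapsTo hy).1
  rw [show 2 * x / 2 = x by ring, Function.iterate_one] at h
  rw [show 3 = 2 * 1 + 1 by rfl, h, abs_lt]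
  constructor <;> linarith [hx.1, hx.2]

/-- The points within `ε` of a dyadic rational of level `M` in `[0,1]`. -/
def dyadicNhd (M : ℕ) (ε : ℝ) : Set ℝ :=
  ⋃ j ∈ Finset.range (2 ^ M + 1), Metric.ball ((j : ℝ) / 2 ^ M) ε

theorem measurableSet_dyadicNhd (M : ℕ) (ε : ℝ) : MeasurableSet (dyadicNhd M ε) :=
  Finset.measurableSet_biUnion _ fun _ _ => measurableSet_ball

theorem volume_dyadicNhd_le (M : ℕ) (ε : ℝ) (hε : 0 < ε) :
    volume (dyadicNhd M ε) ≤ ENNReal.ofReal (2 ^ (M + 2) * ε) := by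
  refine (measure_biUnion_finset_le _ _).trans ?_
  simp only [Real.volume_ball, Finset.sum_const, Finset.card_range, nsmul_eq_mul]
  rw [← ENNReal.ofReal_natCast, ← ENNReal.ofReal_mul (by positivity)]
  refine ENNReal.ofReal_le_ofReal ?_
  push_cast
  have : (1:ℝ) ≤ 2 ^ M := one_le_pow₀ (by norm_num)
  have e : (2:ℝ) ^ (M + 2) = 4 * 2 ^ M := by ring
  rw [e]
  nlinarith

theorem floor_eq_of_notMem_dyadicNhd {M : ℕ} {ε x x' : ℝ} (hx : x ∈ Ico (0:ℝ) 1)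
    (hB : x ∉ dyadicNhd M ε) (h : |x' - x| < ε) :
    ⌊(2:ℝ) ^ M * x'⌋ = ⌊(2:ℝ) ^ M * x⌋ := by
  have hp : (0:ℝ) < 2 ^ M := by positivity
  have hb := floor_two_pow_mul_mem M hx
  have far (j : ℕ) (hj : j ≤ 2 ^ M) : ε ≤ |x - j / 2 ^ M| := by
    by_contra! hlt
    exact hB (mem_biUnion (by simpa using Nat.lt_succ_of_le hj)
      (by simpa [Metric.mem_ball, Real.dist_eq] using hlt))
  obtain ⟨i, hi⟩ := Int.eq_ofNat_of_zero_le hb.1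
  rw [hi] at hb ⊢
  have hi2 : i < 2 ^ M := by exact_mod_cast hb.2
  have h1 := far i hi2.le
  have h2 := far (i + 1) hi2
  rw [Int.floor_eq_iff] at hi ⊢
  push_cast at hi h2 ⊢
  have l1 : (i:ℝ) / 2 ^ M ≤ x := by rw [div_le_iff₀' hp]; exact hi.1
  have l2 : x < ((i:ℝ) + 1) / 2 ^ M := by rw [lt_div_iff₀' hp]; exact hi.2
  rw [abs_of_nonneg (by linarith)] at h1
  rw [abs_of_nonpos (by linarith)] at h2
  rw [abs_lt] at h
  rw [← div_le_iff₀' hp, ← lt_div_iff₀' hp]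
  constructor <;> linarith

theorem firstReturn_mem {T : ℝ → ℝ} (hT : IsDyadicOdometer T) {x ε : ℝ} (hε : 0 < ε)
    (hx : x ∈ Ico (0:ℝ) 1) :
    0 < firstReturn T (Metric.ball x ε) x ∧
      |T^[firstReturn T (Metric.ball x ε) x] x - x| < ε := by
  obtain ⟨n, hn⟩ := exists_pow_lt_of_lt_one hε (by norm_num : (1/2:ℝ) < 1)
  exact Nat.sInf_mem (s := {k : ℕ | 0 < k ∧ T^[k] x ∈ Metric.ball x ε})
    ⟨2 ^ n, by positivity, (hT.abs_iterate_two_pow_sub_lt n hx).trans hn⟩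

theorem firstReturn_le {T : ℝ → ℝ} {x ε : ℝ} {k : ℕ} (hk : 0 < k) (h : |T^[k] x - x| < ε) :
    firstReturn T (Metric.ball x ε) x ≤ k :=
  Nat.sInf_le ⟨hk, h⟩

theorem firstReturn_le_two_pow {T : ℝ → ℝ} (hT : IsDyadicOdometer T) {x ε : ℝ} {n : ℕ}
    (hn : (1/2) ^ n ≤ ε) (hx : x ∈ Ico (0:ℝ) 1) :
    firstReturn T (Metric.ball x ε) x ≤ 2 ^ n :=
  firstReturn_le (by positivity) ((hT.abs_iterate_two_pow_sub_lt n hx).trans_le hn)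

theorem two_pow_le_firstReturn {T : ℝ → ℝ} (hT : IsDyadicOdometer T) {x ε : ℝ} {M : ℕ}
    (hε : 0 < ε) (hx : x ∈ Ico (0:ℝ) 1) (hB : x ∉ dyadicNhd M ε) :
    2 ^ M ≤ firstReturn T (Metric.ball x ε) x := by
  obtain ⟨h0, h1⟩ := hT.firstReturn_mem hε hx
  exact Nat.le_of_dvd h0 (hT.two_pow_dvd_of_floor_eq M _ x hx
    (floor_eq_of_notMem_dyadicNhd hx hB h1))

theorem aemeasurable_firstReturn {T : ℝ → ℝ} (hT : IsDyadicOdometer T) (hm : Measurable T)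
    {ε : ℝ} (hε : 0 < ε) :
    AEMeasurable (fun x => firstReturn T (Metric.ball x ε) x)
      (volume.restrict (Ico (0:ℝ) 1)) := by
  classical
  let p : ℝ → ℕ → Prop := fun x k => x ∈ (Ico (0:ℝ) 1)ᶜ ∨ (0 < k ∧ |T^[k] x - x| < ε)
  have hp (x : ℝ) : ∃ k, p x k := by
    by_cases hx : x ∈ Ico (0:ℝ) 1
    · exact ⟨_, Or.inr (hT.firstReturn_mem hε hx)⟩
    · exact ⟨0, Or.inl hx⟩
  refine ⟨fun x => Nat.find (hp x), measurable_find hp fun k => ?_, ?_⟩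
  · refine measurableSet_Ico.compl.union (MeasurableSet.inter (.const _) ?_)
    exact measurableSet_lt (((hm.iterate k).sub measurable_id).norm) measurable_const
  · filter_upwards [ae_restrict_mem measurableSet_Ico] with x hx
    refine (le_antisymm (Nat.find_min' _ (Or.inr (hT.firstReturn_mem hε hx))) ?_).symm
    obtain h | h := Nat.find_spec (hp x)
    · exact absurd hx h
    · exact firstReturn_le h.1 h.2

theorem retPF_eq {T : ℝ → ℝ} (hT : IsDyadicOdometer T) {ε : ℝ} (hε : 0 < ε) (q : ℝ) :
    retPF T (volume.restrict (Icc (0:ℝ) 1)) ε q =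
      ∫⁻ x in Ico (0:ℝ) 1,
        ENNReal.ofReal ((firstReturn T (Metric.ball x ε) x : ℝ) ^ (1 - q)) := by
  rw [retPF, ← Measure.restrict_congr_set (Ico_ae_eq_Icc (μ := volume))]
  refine setLIntegral_congr_fun measurableSet_Ico fun x hx => ?_
  have := (hT.firstReturn_mem hε hx).1
  rw [← ENNReal.ofReal_rpow_of_pos (by exact_mod_cast this), ENNReal.ofReal_natCast]

theorem ofReal_le_volume_diff_dyadicNhd (M : ℕ) {ε : ℝ} (hε : 0 < ε) :
    ENNReal.ofReal (1 - 2 ^ (M + 2) * ε) ≤ volume (Ico (0:ℝ) 1 \ dyadicNhd M ε) := by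
  refine le_trans ?_ le_measure_sdiff
  rw [ENNReal.ofReal_sub _ (by positivity), Real.volume_Ico, sub_zero]
  exact tsub_le_tsub_left (volume_dyadicNhd_le M ε hε) _

/-- A constant lower bound for a function on a measurable subset bounds its integral. -/
theorem mul_volume_le_setLIntegral {f : ℝ → ℝ≥0∞} {s t : Set ℝ} {c : ℝ≥0∞}
    (ht : MeasurableSet t) (hts : t ⊆ s) (h : ∀ x ∈ t, c ≤ f x) :
    c * volume t ≤ ∫⁻ x in s, f x := by
  rw [← setLIntegral_const]
  exact (setLIntegral_mono' ht h).trans (lintegral_mono_set hts)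

theorem retPF_le_of_le_one {T : ℝ → ℝ} (hT : IsDyadicOdometer T) {ε q : ℝ} {n : ℕ}
    (hn : (1/2) ^ n ≤ ε) (hq : q ≤ 1) :
    retPF T (volume.restrict (Icc (0:ℝ) 1)) ε q ≤ ENNReal.ofReal ((2 ^ n) ^ (1 - q)) := by
  have hε : 0 < ε := lt_of_lt_of_le (by positivity) hn
  rw [hT.retPF_eq hε]
  calc _ ≤ ∫⁻ x in Ico (0:ℝ) 1, ENNReal.ofReal ((2 ^ n) ^ (1 - q)) := by
        refine setLIntegral_mono' measurableSet_Ico fun x hx => ENNReal.ofReal_le_ofReal ?_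
        refine Real.rpow_le_rpow (by positivity) ?_ (by linarith)
        exact_mod_cast hT.firstReturn_le_two_pow hn hx
    _ = _ := by simp

theorem le_retPF_of_le_one {T : ℝ → ℝ} (hT : IsDyadicOdometer T) {ε q : ℝ} (hε : 0 < ε)
    (hq : q ≤ 1) (M : ℕ) :
    ENNReal.ofReal ((2 ^ M) ^ (1 - q) * (1 - 2 ^ (M + 2) * ε)) ≤
      retPF T (volume.restrict (Icc (0:ℝ) 1)) ε q := by
  rw [hT.retPF_eq hε, ENNReal.ofReal_mul (by positivity)]
  refine (mul_le_mul_right (ofReal_le_volume_diff_dyadicNhd M hε) _).trans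
    (mul_volume_le_setLIntegral (measurableSet_Ico.diff (measurableSet_dyadicNhd M ε))
      sdiff_subset fun x hx => ENNReal.ofReal_le_ofReal ?_)
  refine Real.rpow_le_rpow (by positivity) ?_ (by linarith)
  exact_mod_cast hT.two_pow_le_firstReturn hε hx.1 hx.2

theorem le_retPF_of_one_le {T : ℝ → ℝ} (hT : IsDyadicOdometer T) {ε q : ℝ} {n : ℕ}
    (hn : (1/2) ^ n ≤ ε) (hq : 1 ≤ q) :
    ENNReal.ofReal ((2 ^ n) ^ (1 - q)) ≤ retPF T (volume.restrict (Icc (0:ℝ) 1)) ε q := by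
  have hε : 0 < ε := lt_of_lt_of_le (by positivity) hn
  rw [hT.retPF_eq hε]
  calc _ = ENNReal.ofReal ((2 ^ n) ^ (1 - q)) * volume (Ico (0:ℝ) 1) := by simp
    _ ≤ _ := by
        refine mul_volume_le_setLIntegral measurableSet_Ico subset_rfl
          fun x hx => ENNReal.ofReal_le_ofReal ?_
        have := (hT.firstReturn_mem hε hx).1
        refine Real.rpow_le_rpow_of_nonpos (by exact_mod_cast this) ?_ (by linarith)
        exact_mod_cast hT.firstReturn_le_two_pow hn hx

theorem le_retPF_of_three_step_return {T : ℝ → ℝ} (hT : IsDyadicOdometer T) {ε q : ℝ} {n : ℕ}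
    (hn : (1/2) ^ n ≤ ε) (hq : 1 ≤ q) :
    ENNReal.ofReal (3 ^ (1 - q) * (1/2) ^ (n + 1)) ≤
      retPF T (volume.restrict (Icc (0:ℝ) 1)) ε q := by
  have hε : 0 < ε := lt_of_lt_of_le (by positivity) hn
  have hp : (1/2:ℝ) ^ (n + 1) ≤ 1/2 := by
    rw [pow_succ]
    have : (1/2:ℝ) ^ n ≤ 1 := pow_le_one₀ (by norm_num) (by norm_num)
    linarith
  rw [hT.retPF_eq hε]
  calc _ = ENNReal.ofReal (3 ^ (1 - q)) *
          volume (Ico (1/2 - (1/2) ^ (n + 1)) (1/2:ℝ)) := by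
        rw [Real.volume_Ico, ENNReal.ofReal_mul (by positivity)]; congr 2; ring
    _ ≤ _ := by
        have hsub : Ico (1/2 - (1/2) ^ (n + 1)) (1/2:ℝ) ⊆ Ico 0 1 :=
          Ico_subset_Ico (by linarith) (by norm_num)
        refine mul_volume_le_setLIntegral measurableSet_Ico hsub
          fun x hx => ENNReal.ofReal_le_ofReal ?_
        have := (hT.firstReturn_mem hε (hsub hx)).1
        refine Real.rpow_le_rpow_of_nonpos (by exact_mod_cast this) ?_ (by linarith)
        exact_mod_cast firstReturn_le (by norm_num)
          ((hT.abs_iterate_three_sub_lt n hx).trans_le hn)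

theorem firstReturn_rpow_le {T : ℝ → ℝ} (hT : IsDyadicOdometer T) {ε a x : ℝ} (hε : 0 < ε)
    (ha : a ≤ 0) (hx : x ∈ Ico (0:ℝ) 1) (M : ℕ) :
    ENNReal.ofReal ((firstReturn T (Metric.ball x ε) x : ℝ) ^ a) ≤
      ENNReal.ofReal ((2 ^ M) ^ a) + ∑ m ∈ Finset.range M,
        (dyadicNhd (m + 1) ε).indicator (fun _ => ENNReal.ofReal ((2 ^ m) ^ a)) x := by
  induction M with
  | zero =>
    simp only [pow_zero, Finset.range_zero, Finset.sum_empty, add_zero]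
    refine ENNReal.ofReal_le_ofReal (Real.rpow_le_rpow_of_nonpos one_pos ?_ ha)
    exact_mod_cast (hT.firstReturn_mem hε hx).1
  | succ M ih =>
    by_cases hB : x ∈ dyadicNhd (M + 1) ε
    · rw [Finset.sum_range_succ, indicator_of_mem hB, add_comm (Finset.sum _ _)]
      exact ih.trans le_add_self
    · refine le_add_right (ENNReal.ofReal_le_ofReal
        (Real.rpow_le_rpow_of_nonpos (by positivity) ?_ ha))
      exact_mod_cast hT.two_pow_le_firstReturn hε hx hB

theorem retPF_le_sum {T : ℝ → ℝ} (hT : IsDyadicOdometer T) {ε q : ℝ} (hε : 0 < ε)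
    (hq : 1 ≤ q) (M : ℕ) :
    retPF T (volume.restrict (Icc (0:ℝ) 1)) ε q ≤
      ENNReal.ofReal ((2 ^ M) ^ (1 - q) +
        ∑ m ∈ Finset.range M, (2 ^ m) ^ (1 - q) * (2 ^ (m + 3) * ε)) := by
  rw [hT.retPF_eq hε]
  refine (setLIntegral_mono' measurableSet_Ico fun x hx =>
    hT.firstReturn_rpow_le hε (by linarith : 1 - q ≤ 0) hx M).trans ?_
  have hmeas (m : ℕ) : Measurable ((dyadicNhd (m + 1) ε).indicator
      (fun _ => ENNReal.ofReal ((2 ^ m) ^ (1 - q)))) :=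
    measurable_const.indicator (measurableSet_dyadicNhd _ _)
  rw [lintegral_add_left measurable_const, lintegral_finsetSum _ fun m _ => hmeas m,
    ENNReal.ofReal_add (by positivity) (Finset.sum_nonneg fun m _ => by positivity),
    ENNReal.ofReal_sum_of_nonneg fun m _ => by positivity]
  refine add_le_add (by simp) (Finset.sum_le_sum fun m _ => ?_)
  rw [lintegral_indicator_const (measurableSet_dyadicNhd _ _), ENNReal.ofReal_mul (by positivity)]
  gcongr
  exact (Measure.restrict_apply_le _ _).trans (volume_dyadicNhd_le (m + 1) ε hε)

theorem retPF_le_of_one_le {T : ℝ → ℝ} (hT : IsDyadicOdometer T) {ε q : ℝ} {n : ℕ}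
    (hε : 0 < ε) (hn : ε ≤ 2 * (1/2) ^ n) (hq : 1 ≤ q) :
    retPF T (volume.restrict (Icc (0:ℝ) 1)) ε q ≤
      ENNReal.ofReal ((16 * n + 1) * (2 ^ n) ^ (-min (q - 1) 1)) := by
  refine (hT.retPF_le_sum hε hq n).trans (ENNReal.ofReal_le_ofReal ?_)
  set b := min (q - 1) 1 with hb
  have hb1 : b ≤ 1 := min_le_right _ _
  have hbq : 1 - q ≤ -b := by linarith [min_le_left (q - 1) 1]
  have one_le (m : ℕ) : (1:ℝ) ≤ 2 ^ m := one_le_pow₀ (by norm_num)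
  have term (m : ℕ) (hm : m ∈ Finset.range n) :
      ((2:ℝ) ^ m) ^ (1 - q) * (2 ^ (m + 3) * ε) ≤ 16 * (2 ^ n) ^ (-b) := by
    have hpn : (0:ℝ) < 2 ^ n := by positivity
    have hpm : (0:ℝ) < 2 ^ m := by positivity
    calc ((2:ℝ) ^ m) ^ (1 - q) * (2 ^ (m + 3) * ε)
        ≤ (2 ^ m) ^ (-b) * (2 ^ (m + 3) * (2 * (1/2) ^ n)) := by
          gcongr
          exact one_le m
      _ = 16 * (((2:ℝ) ^ m) ^ (1 - b) * (1/2) ^ n) := by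
          rw [show 1 - b = -b + 1 by ring, Real.rpow_add hpm, Real.rpow_one]; ring
      _ ≤ 16 * (((2:ℝ) ^ n) ^ (1 - b) * (1/2) ^ n) := by
          gcongr
          · norm_num
          · exact (Finset.mem_range.1 hm).le
      _ = 16 * (2 ^ n) ^ (-b) := by
          rw [show 1 - b = -b + 1 by ring, Real.rpow_add hpn, Real.rpow_one, mul_assoc,
            ← mul_pow]
          norm_num
  calc _ ≤ ((2:ℝ) ^ n) ^ (-b) + ∑ m ∈ Finset.range n, 16 * ((2:ℝ) ^ n) ^ (-b) := by
        refine add_le_add ?_ (Finset.sum_le_sum term)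
        gcongr
        exact one_le n
    _ = _ := by simp; ring

end IsDyadicOdometer

theorem log_toReal_bounds {F : ℝ≥0∞} {a b : ℝ} (ha : 0 < a) (h1 : ENNReal.ofReal a ≤ F)
    (h2 : F ≤ ENNReal.ofReal b) :
    F ≠ 0 ∧ F ≠ ⊤ ∧ Real.log a ≤ Real.log F.toReal ∧ Real.log F.toReal ≤ Real.log b := by
  have hb : F ≠ ⊤ := (h2.trans_lt ENNReal.ofReal_lt_top).ne
  have hF : a ≤ F.toReal := (ENNReal.ofReal_le_iff_le_toReal hb).1 h1
  have hFb : F.toReal ≤ b := by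
    refine ENNReal.toReal_le_of_le_ofReal ?_ h2
    by_contra! h
    rw [ENNReal.ofReal_of_nonpos h.le, nonpos_iff_eq_zero] at h2
    simp [h2] at hF
    linarith
  refine ⟨fun h => ?_, hb, Real.log_le_log ha hF, Real.log_le_log (ha.trans_le hF) hFb⟩
  simp [h] at hF
  linarith

/-- Logarithmic growth of `g` at dyadic scales, up to a logarithmic error, determines
its scaling exponent. -/
theorem tendsto_div_log_of_dyadic_bound {g : ℝ → ℝ} {a C : ℝ}
    (h : ∀ n : ℕ, 4 ≤ n → ∀ ε : ℝ, (1/2) ^ n ≤ ε → ε ≤ 2 * (1/2) ^ n →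
      |g ε - a * (n * Real.log 2)| ≤ C + Real.log (16 * n + 1)) :
    Tendsto (fun ε => g ε / Real.log ε) (𝓝[>] (0:ℝ)) (𝓝 (-a)) := by
  have l2 : 0 < Real.log 2 := Real.log_pos (by norm_num)
  set β := 16 / Real.log 2 with hβ
  have hβ0 : 0 < β := by positivity
  set K := |a| * Real.log 2 + C with hK
  have err : Tendsto (fun L : ℝ => (K + Real.log (β * L + 17)) / L) atTop (𝓝 0) := by
    have t1 : Tendsto (fun L : ℝ => β * L + 17) atTop atTop :=
      tendsto_atTop_add_const_right _ _ (tendsto_id.const_mul_atTop hβ0)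
    have o1 : (fun L : ℝ => Real.log (β * L + 17)) =o[atTop] (fun L : ℝ => L) := by
      refine (Real.isLittleO_log_id_atTop.comp_tendsto t1).trans_isBigO ?_
      refine ((Asymptotics.isBigO_refl _ _).const_mul_left β).add ?_
      exact (Asymptotics.isLittleO_const_id_atTop (17:ℝ)).isBigO
    exact ((Asymptotics.isLittleO_const_id_atTop K).add o1).tendsto_div_nhds_zero
  have tl : Tendsto (fun ε : ℝ => -Real.log ε) (𝓝[>] (0:ℝ)) atTop :=
    tendsto_neg_atBot_atTop.comp Real.tendsto_log_nhdsGT_zero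
  rw [tendsto_iff_norm_sub_tendsto_zero]
  refine squeeze_zero' (.of_forall fun _ => norm_nonneg _) ?_ (err.comp tl)
  have small : ∀ᶠ ε : ℝ in 𝓝[>] 0, ε < (1/2) ^ 4 :=
    nhdsWithin_le_nhds (eventually_lt_nhds (by norm_num))
  filter_upwards [small, self_mem_nhdsWithin] with ε hε (h0 : 0 < ε)
  obtain ⟨m, h1, h2⟩ := exists_nat_pow_near_of_lt_one h0
    (by norm_num at hε; linarith : ε ≤ 1) (by norm_num : (0:ℝ) < 1/2) (by norm_num)
  have hm : 4 ≤ m + 1 := by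
    by_contra! hlt
    have : (1/2:ℝ) ^ 4 ≤ (1/2) ^ (m + 1) :=
      pow_le_pow_of_le_one (by norm_num) (by norm_num) hlt.le
    linarith
  have hb := h (m + 1) hm ε h1.le (by rw [pow_succ]; linarith)
  have lb : Real.log ((1/2:ℝ)) = -Real.log 2 := by rw [one_div, Real.log_inv]
  have g1 := Real.log_le_log (by positivity) h1.le
  have g2 := Real.log_le_log h0 h2
  rw [Real.log_pow, lb] at g1 g2
  push_cast at g1 hb
  have L0 : 0 < -Real.log ε := by
    have := Real.log_neg h0 (by norm_num at hε; linarith); linarith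
  have key : |g ε - a * -Real.log ε| ≤ K + Real.log (β * -Real.log ε + 17) := by
    have e1 : |a * ((m + 1) * Real.log 2) - a * -Real.log ε| ≤ |a| * Real.log 2 := by
      rw [← mul_sub, abs_mul]
      gcongr
      rw [abs_le]; constructor <;> linarith
    have e2 : Real.log (16 * ((m:ℝ) + 1) + 1) ≤ Real.log (β * -Real.log ε + 17) := by
      refine Real.log_le_log (by positivity) ?_
      have : (m:ℝ) ≤ -Real.log ε / Real.log 2 := by rw [le_div_iff₀ l2]; linarith
      have e3 : β * -Real.log ε = 16 * (-Real.log ε / Real.log 2) := by rw [hβ]; ring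
      rw [e3]; linarith
    calc _ ≤ |g ε - a * ((m + 1) * Real.log 2)| +
          |a * ((m + 1) * Real.log 2) - a * -Real.log ε| := abs_sub_le _ _ _
      _ ≤ _ := by rw [hK]; linarith
  have hne : Real.log ε ≠ 0 := by linarith
  calc ‖g ε / Real.log ε - -a‖ = |g ε - a * -Real.log ε| / -Real.log ε := by
        rw [Real.norm_eq_abs, show g ε / Real.log ε - -a = (g ε - a * -Real.log ε) / Real.log ε by
          field_simp, abs_div, abs_of_neg (by linarith : Real.log ε < 0)]
    _ ≤ _ := by simp only [Function.comp_apply]; gcongr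

theorem tendsto_dimScale {F : ℝ → ℝ≥0∞} {q a C : ℝ}
    (h : ∀ n : ℕ, 4 ≤ n → ∀ ε : ℝ, (1/2) ^ n ≤ ε → ε ≤ 2 * (1/2) ^ n →
      F ε ≠ 0 ∧ F ε ≠ ⊤ ∧
        |Real.log (F ε).toReal - a * (n * Real.log 2)| ≤ C + Real.log (16 * n + 1)) :
    Tendsto (dimScale F q) (𝓝[>] (0:ℝ)) (𝓝 ((-a / (q - 1) : ℝ) : EReal)) := by
  have t := (tendsto_div_log_of_dyadic_bound (g := fun ε => Real.log (F ε).toReal)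
    fun n hn ε h1 h2 => (h n hn ε h1 h2).2.2).div_const (q - 1)
  refine ((continuous_coe_real_ereal.tendsto _).comp t).congr' ?_
  have small : ∀ᶠ ε : ℝ in 𝓝[>] 0, ε < (1/2) ^ 4 :=
    nhdsWithin_le_nhds (eventually_lt_nhds (by norm_num))
  filter_upwards [small, self_mem_nhdsWithin] with ε hε (h0 : 0 < ε)
  obtain ⟨m, h1, h2⟩ := exists_nat_pow_near_of_lt_one h0
    (by norm_num at hε; linarith : ε ≤ 1) (by norm_num : (0:ℝ) < 1/2) (by norm_num)
  have hm : 4 ≤ m + 1 := by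
    by_contra! hlt
    have : (1/2:ℝ) ^ 4 ≤ (1/2) ^ (m + 1) :=
      pow_le_pow_of_le_one (by norm_num) (by norm_num) hlt.le
    linarith
  obtain ⟨f0, f1, -⟩ := h (m + 1) hm ε h1.le (by rw [pow_succ]; linarith)
  rw [Function.comp_apply, dimScale, elog, if_neg f0, if_neg f1, ← EReal.coe_mul, div_div,
    mul_comm (Real.log ε), inv_mul_eq_div]

theorem dimPlus_eq_and_dimMinus_eq {F : ℝ → ℝ≥0∞} {Flog : ℝ → ℝ} {q a C : ℝ} (hq : q ≠ 1)
    (h : ∀ n : ℕ, 4 ≤ n → ∀ ε : ℝ, (1/2) ^ n ≤ ε → ε ≤ 2 * (1/2) ^ n →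
      F ε ≠ 0 ∧ F ε ≠ ⊤ ∧
        |Real.log (F ε).toReal - a * (n * Real.log 2)| ≤ C + Real.log (16 * n + 1)) :
    dimPlus F Flog q = ((-a / (q - 1) : ℝ) : EReal) ∧
      dimMinus F Flog q = ((-a / (q - 1) : ℝ) : EReal) := by
  have t := tendsto_dimScale (q := q) h
  rw [dimPlus, dimMinus, if_neg hq, if_neg hq]
  exact ⟨t.limsup_eq, t.liminf_eq⟩

namespace IsDyadicOdometer

theorem two_pow_sub_four_mul_le {ε : ℝ} {n : ℕ} (h4 : 4 ≤ n) (hn : ε ≤ 2 * (1/2) ^ n) :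
    2 ^ (n - 4 + 2) * ε ≤ 1/2 := by
  obtain ⟨k, rfl⟩ := Nat.exists_eq_add_of_le' h4
  calc (2:ℝ) ^ (k + 4 - 4 + 2) * ε ≤ 2 ^ (k + 2) * (2 * (1/2) ^ (k + 4)) := by
        rw [Nat.add_sub_cancel]; gcongr
    _ = (2 * (1/2)) ^ k * (1/2) := by rw [mul_pow]; ring
    _ = 1/2 := by norm_num

theorem dims_of_lt_one {T : ℝ → ℝ} (hT : IsDyadicOdometer T) {q : ℝ} (hq : q < 1) :
    DtauPlus T (volume.restrict (Icc (0:ℝ) 1)) q = 1 ∧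
      DtauMinus T (volume.restrict (Icc (0:ℝ) 1)) q = 1 := by
  have l2 : 0 < Real.log 2 := Real.log_pos (by norm_num)
  have key := dimPlus_eq_and_dimMinus_eq
    (F := fun ε => retPF T (volume.restrict (Icc (0:ℝ) 1)) ε q)
    (Flog := retPFlog T (volume.restrict (Icc (0:ℝ) 1))) (a := 1 - q)
    (C := (4 * (1 - q) + 1) * Real.log 2) hq.ne fun n hn ε h1 h2 => by
      have hε : 0 < ε := lt_of_lt_of_le (by positivity) h1
      have low : ENNReal.ofReal ((2 ^ (n - 4)) ^ (1 - q) * (1/2)) ≤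
          retPF T (volume.restrict (Icc (0:ℝ) 1)) ε q := by
        refine (ENNReal.ofReal_le_ofReal ?_).trans (hT.le_retPF_of_le_one hε hq.le (n - 4))
        gcongr
        linarith [two_pow_sub_four_mul_le hn h2]
      obtain ⟨f0, f1, b1, b2⟩ := log_toReal_bounds (by positivity) low
        (hT.retPF_le_of_le_one h1 hq.le)
      refine ⟨f0, f1, ?_⟩
      have hlog : 0 ≤ Real.log (16 * n + 1) := Real.log_nonneg (by linarith [n.cast_nonneg (α := ℝ)])
      rw [Real.log_mul (by positivity) (by norm_num), Real.log_rpow (by positivity),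
        Real.log_pow, one_div, Real.log_inv, Nat.cast_sub hn] at b1
      rw [Real.log_rpow (by positivity), Real.log_pow] at b2
      have : 0 < (1 - q) * Real.log 2 := mul_pos (by linarith) l2
      push_cast at b1
      rw [abs_le]; constructor <;> linarith
  have e : -(1 - q) / (q - 1) = 1 := by rw [neg_sub]; exact div_self (by linarith)
  rw [e] at key
  simpa [DtauPlus, DtauMinus] using key

theorem dims_of_one_lt {T : ℝ → ℝ} (hT : IsDyadicOdometer T) {q : ℝ} (hq : 1 < q) :
    DtauPlus T (volume.restrict (Icc (0:ℝ) 1)) q = ((min (q - 1) 1 / (q - 1) : ℝ) : EReal) ∧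
      DtauMinus T (volume.restrict (Icc (0:ℝ) 1)) q =
        ((min (q - 1) 1 / (q - 1) : ℝ) : EReal) := by
  have l2 : 0 < Real.log 2 := Real.log_pos (by norm_num)
  have l3 : 0 < (q - 1) * Real.log 3 := mul_pos (by linarith) (Real.log_pos (by norm_num))
  have key := dimPlus_eq_and_dimMinus_eq
    (F := fun ε => retPF T (volume.restrict (Icc (0:ℝ) 1)) ε q)
    (Flog := retPFlog T (volume.restrict (Icc (0:ℝ) 1))) (a := -min (q - 1) 1)
    (C := (q - 1) * Real.log 3 + Real.log 2) hq.ne' fun n hn ε h1 h2 => by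
      have hε : 0 < ε := lt_of_lt_of_le (by positivity) h1
      have up := hT.retPF_le_of_one_le hε h2 hq.le
      obtain ⟨f0, f1, b1, b2⟩ := log_toReal_bounds (by positivity)
        (hT.le_retPF_of_one_le h1 hq.le) up
      obtain ⟨-, -, b3, -⟩ := log_toReal_bounds (by positivity)
        (hT.le_retPF_of_three_step_return h1 hq.le) up
      refine ⟨f0, f1, ?_⟩
      have hlog : 0 ≤ Real.log (16 * n + 1) := Real.log_nonneg (by linarith [n.cast_nonneg (α := ℝ)])
      rw [Real.log_rpow (by positivity), Real.log_pow] at b1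
      rw [Real.log_mul (by positivity) (by positivity), Real.log_rpow (by positivity),
        Real.log_pow] at b2
      rw [Real.log_mul (by positivity) (by positivity), Real.log_rpow (by norm_num),
        Real.log_pow, one_div, Real.log_inv] at b3
      push_cast at b3
      rw [abs_le]
      rcases min_choice (q - 1) 1 with hmin | hmin <;> rw [hmin] at b2 ⊢ <;>
        constructor <;> linarith
  rw [neg_neg] at key
  exact key

theorem neg_retPFlog_bounds {T : ℝ → ℝ} (hT : IsDyadicOdometer T) (hm : Measurable T) {ε : ℝ}
    {n : ℕ} (hn : (1/2) ^ n ≤ ε) (M : ℕ) :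
    M * Real.log 2 * (1 - 2 ^ (M + 2) * ε) ≤
        -retPFlog T (volume.restrict (Icc (0:ℝ) 1)) ε ∧
      -retPFlog T (volume.restrict (Icc (0:ℝ) 1)) ε ≤ n * Real.log 2 := by
  have hε : 0 < ε := lt_of_lt_of_le (by positivity) hn
  have l2 : 0 < Real.log 2 := Real.log_pos (by norm_num)
  set f : ℝ → ℝ := fun x => Real.log (firstReturn T (Metric.ball x ε) x : ℝ) with hf
  have eq : -retPFlog T (volume.restrict (Icc (0:ℝ) 1)) ε = ∫ x in Ico (0:ℝ) 1, f x := by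
    rw [retPFlog, ← integral_neg, ← Measure.restrict_congr_set (Ico_ae_eq_Icc (μ := volume))]
    simp [hf, Real.log_inv]
  have f0 (x : ℝ) : 0 ≤ f x := Real.log_natCast_nonneg _
  have f1 : ∀ x ∈ Ico (0:ℝ) 1, f x ≤ n * Real.log 2 := fun x hx => by
    rw [← Real.log_pow]
    refine Real.log_le_log (by exact_mod_cast (hT.firstReturn_mem hε hx).1) ?_
    exact_mod_cast hT.firstReturn_le_two_pow hn hx
  have hmeas : AEStronglyMeasurable f (volume.restrict (Ico (0:ℝ) 1)) :=
    (Real.measurable_log.comp_aemeasurable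
      ((measurable_from_top (f := fun k : ℕ => (k:ℝ))).comp_aemeasurable
        (hT.aemeasurable_firstReturn hm hε))).aestronglyMeasurable
  have hfint : IntegrableOn f (Ico (0:ℝ) 1) := by
    refine Integrable.of_bound hmeas (n * Real.log 2) ?_
    filter_upwards [ae_restrict_mem measurableSet_Ico] with x hx
    rw [Real.norm_of_nonneg (f0 x)]; exact f1 x hx
  rw [eq]
  constructor
  · have hsub : Ico (0:ℝ) 1 \ dyadicNhd M ε ⊆ Ico 0 1 := sdiff_subset
    have hS : MeasurableSet (Ico (0:ℝ) 1 \ dyadicNhd M ε) :=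
      measurableSet_Ico.diff (measurableSet_dyadicNhd M ε)
    have hfin : volume (Ico (0:ℝ) 1 \ dyadicNhd M ε) ≠ ⊤ :=
      ((measure_mono hsub).trans_lt (by simp)).ne
    calc M * Real.log 2 * (1 - 2 ^ (M + 2) * ε)
        ≤ M * Real.log 2 * volume.real (Ico (0:ℝ) 1 \ dyadicNhd M ε) := by
          gcongr
          exact (ENNReal.ofReal_le_iff_le_toReal hfin).1 (ofReal_le_volume_diff_dyadicNhd M hε)
      _ ≤ ∫ x in Ico (0:ℝ) 1 \ dyadicNhd M ε, f x := by
          refine setIntegral_ge_of_const_le_real hS hfin (fun x hx => ?_) (hfint.mono_set hsub)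
          rw [← Real.log_pow]
          refine Real.log_le_log (by positivity) ?_
          exact_mod_cast hT.two_pow_le_firstReturn hε hx.1 hx.2
      _ ≤ ∫ x in Ico (0:ℝ) 1, f x :=
          setIntegral_mono_set hfint (.of_forall f0) hsub.eventuallyLE
  · calc ∫ x in Ico (0:ℝ) 1, f x ≤ ∫ x in Ico (0:ℝ) 1, n * Real.log 2 :=
          setIntegral_mono_on hfint (integrable_const _) measurableSet_Ico f1
      _ = _ := by simp

theorem abs_retPFlog_add_le {T : ℝ → ℝ} (hT : IsDyadicOdometer T) (hm : Measurable T) {ε : ℝ}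
    {n : ℕ} (h4 : 4 ≤ n) (hn : (1/2) ^ n ≤ ε) (hn' : ε ≤ 2 * (1/2) ^ n) :
    |retPFlog T (volume.restrict (Icc (0:ℝ) 1)) ε - -1 * (n * Real.log 2)| ≤
      16 * Real.log 2 + Real.log (16 * n + 1) := by
  have l2 : 0 < Real.log 2 := Real.log_pos (by norm_num)
  have hn0 : n ≠ 0 := by omega
  set k := Nat.log 2 n with hk
  have hkn : k ≤ n := Nat.log_le_self 2 n
  obtain ⟨M, hM⟩ := Nat.exists_eq_add_of_le' hkn
  obtain ⟨b1, b2⟩ := hT.neg_retPFlog_bounds hm hn M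
  have hk1 : (2:ℝ) ^ k ≤ n := by exact_mod_cast Nat.pow_log_le_self 2 hn0
  have hk2 : (n:ℝ) ≤ 2 ^ k * 2 := by
    rw [← pow_succ]; exact_mod_cast (Nat.lt_pow_succ_log_self (by norm_num) n).le
  have c1 : k * Real.log 2 ≤ Real.log (16 * n + 1) := by
    rw [← Real.log_pow]
    exact Real.log_le_log (by positivity) (by linarith [n.cast_nonneg (α := ℝ)])
  have c2 : (2:ℝ) ^ k * (2 ^ (M + 2) * ε) ≤ 8 := by
    calc (2:ℝ) ^ k * (2 ^ (M + 2) * ε) ≤ 2 ^ k * (2 ^ (M + 2) * (2 * (1/2) ^ (M + k))) := by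
          rw [hM] at hn'; gcongr
      _ = 8 * (2 * (1/2)) ^ (M + k) := by rw [mul_pow]; ring
      _ = 8 := by norm_num
  have hε : 0 < ε := lt_of_lt_of_le (by positivity) hn
  have c3 : M * (2 ^ (M + 2) * ε) ≤ 16 := by
    have hMn : (M:ℝ) ≤ n := by exact_mod_cast (by omega : M ≤ n)
    have : (M:ℝ) * (2 ^ (M + 2) * ε) ≤ (2 ^ k * 2) * (2 ^ (M + 2) * ε) := by
      gcongr; linarith
    linarith
  have c4 : Real.log 2 * (M * (2 ^ (M + 2) * ε)) ≤ Real.log 2 * 16 := by gcongr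
  have c5 : (n:ℝ) = M + k := by exact_mod_cast hM
  rw [abs_le]
  constructor
  · have : 0 ≤ Real.log (16 * n + 1) := Real.log_nonneg (by linarith [n.cast_nonneg (α := ℝ)])
    linarith
  · rw [c5] at c1 ⊢
    linarith

theorem dims_one {T : ℝ → ℝ} (hT : IsDyadicOdometer T) (hm : Measurable T) :
    DtauPlus T (volume.restrict (Icc (0:ℝ) 1)) 1 = 1 ∧
      DtauMinus T (volume.restrict (Icc (0:ℝ) 1)) 1 = 1 := by
  have t := tendsto_div_log_of_dyadic_bound fun n h4 ε h1 h2 =>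
    hT.abs_retPFlog_add_le hm (ε := ε) (n := n) h4 h1 h2
  rw [neg_neg] at t
  simp [DtauPlus, DtauMinus, dimPlus, dimMinus, t.limsup_eq, t.liminf_eq]

end IsDyadicOdometer

/-- For the von Neumann–Kakutani map `T` on `[0,1]` with Lebesgue
measure, the return time generalized dimensions are `D_τ^±(q) = 1` for all `q ≤ 2`
and `D_τ^±(q) = 1/(q-1)` for all `q > 2`. -/
theorem vonNeumann_Kakutani_return_time_dimensions (T : ℝ → ℝ) (hTmeas : Measurable T)
    (hT : ∀ k : ℕ, ∀ x ∈ Set.Ico (1 - (2:ℝ) ^ (-(k:ℤ))) (1 - (2:ℝ) ^ (-(k:ℤ) - 1)),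
      T x = x - 1 + (2:ℝ) ^ (-(k:ℤ)) + (2:ℝ) ^ (-(k:ℤ) - 1))
    (hT1 : T 1 = 0) :
    (∀ q : ℝ, q ≤ 2 →
      DtauPlus T (volume.restrict (Set.Icc (0:ℝ) 1)) q = (1 : EReal) ∧
        DtauMinus T (volume.restrict (Set.Icc (0:ℝ) 1)) q = (1 : EReal)) ∧
    (∀ q : ℝ, 2 < q →
      DtauPlus T (volume.restrict (Set.Icc (0:ℝ) 1)) q = (((q - 1)⁻¹ : ℝ) : EReal) ∧
        DtauMinus T (volume.restrict (Set.Icc (0:ℝ) 1)) q =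
          (((q - 1)⁻¹ : ℝ) : EReal)) := by
  have h := isDyadicOdometer_of_piecewise hT
  refine ⟨fun q hq => ?_, fun q hq => ?_⟩
  · rcases lt_trichotomy q 1 with hq1 | rfl | hq1
    · exact h.dims_of_lt_one hq1
    · exact h.dims_one hTmeas
    · have key := h.dims_of_one_lt hq1
      rw [min_eq_left (by linarith), div_self (by linarith)] at key
      exact key
  · have key := h.dims_of_one_lt (by linarith : 1 < q)
    rwa [min_eq_right (by linarith), one_div] at key
end

section
/- For the Gaspard–Wang map T with parameter p < −1 and its unique absolutely continuous invariant probability measure μ, the return time generalized dimensions satisfy D_τ^+(q) = D_τ^-(q) = +∞ for all q < q_c := p + 1, while the generalized measure dimensions take the values D_μ^+(q) = D_μ^-(q) = 1 for q ≤ −p and D_μ^+(q) = D_μ^-(q) = (1 + 1/p)·q/(q−1) for q ≥ −p. -/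
open MeasureTheory Filter Set
open scoped ENNReal Topology NNReal

/-- The sequence `c_j = (j+1)^p` defining the Gaspard–Wang partition of `[0,1]`. -/
noncomputable def gwC (p : ℝ) (j : ℕ) : ℝ := ((j : ℝ) + 1) ^ p

/-- A sequence decreasing strictly from `1` to `0`. -/
structure IsPartitionSeq (c : ℕ → ℝ) : Prop where
  zero : c 0 = 1
  anti : StrictAnti c
  lim : Tendsto c atTop (𝓝 0)

/-- The increasing affine bijection of `(0,1)` onto the `j`-th interval `(c (j+1), c j)`. -/
def branch (c : ℕ → ℝ) (j : ℕ) (x : ℝ) : ℝ := c (j + 1) + (c j - c (j + 1)) * x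

namespace IsPartitionSeq

variable {c : ℕ → ℝ}

lemma len_pos (hc : IsPartitionSeq c) (j : ℕ) : 0 < c j - c (j + 1) :=
  sub_pos.2 (hc.anti (Nat.lt_succ_self j))

lemma pos (hc : IsPartitionSeq c) (j : ℕ) : 0 < c j :=
  (hc.anti.antitone.le_of_tendsto hc.lim (j + 1)).trans_lt (hc.anti (Nat.lt_succ_self j))

lemma le_one (hc : IsPartitionSeq c) (j : ℕ) : c j ≤ 1 :=
  hc.zero ▸ hc.anti.antitone (Nat.zero_le j)

lemma hasSum_len (hc : IsPartitionSeq c) (j : ℕ) :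
    HasSum (fun k => c (j + k) - c (j + k + 1)) (c j) := by
  rw [hasSum_iff_tendsto_nat_of_nonneg (fun k => (hc.len_pos _).le)]
  have h : ∀ n, ∑ k ∈ Finset.range n, (c (j + k) - c (j + k + 1)) = c j - c (n + j) := by
    intro n
    have := Finset.sum_range_sub' (fun k => c (j + k)) n
    simpa [add_assoc, add_comm n j] using this
  simp_rw [h]
  simpa using tendsto_const_nhds.sub (hc.lim.comp (tendsto_add_atTop_nat j))

lemma hasSum_len_zero (hc : IsPartitionSeq c) :
    HasSum (fun k => c k - c (k + 1)) 1 := by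
  simpa [hc.zero] using hc.hasSum_len 0

lemma branch_injective (hc : IsPartitionSeq c) (j : ℕ) : Function.Injective (branch c j) := by
  intro x y h
  have := (hc.len_pos j).ne'
  simpa [branch, this] using h

lemma measurableEmbedding_branch (hc : IsPartitionSeq c) (j : ℕ) :
    MeasurableEmbedding (branch c j) :=
  Continuous.measurableEmbedding (by unfold branch; fun_prop) (hc.branch_injective j)

lemma branch_mem (hc : IsPartitionSeq c) (j : ℕ) {x : ℝ} (hx : x ∈ Ioo (0 : ℝ) 1) :
    branch c j x ∈ Ioo (c (j + 1)) (c j) := by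
  have := hc.len_pos j
  constructor <;> unfold branch <;> nlinarith [hx.1, hx.2]

lemma exists_branch_eq (hc : IsPartitionSeq c) (j : ℕ) {y : ℝ}
    (hy : y ∈ Ioo (c (j + 1)) (c j)) : ∃ x ∈ Ioo (0 : ℝ) 1, branch c j x = y := by
  have h := hc.len_pos j
  refine ⟨(y - c (j + 1)) / (c j - c (j + 1)), ⟨div_pos (by linarith [hy.1]) h, ?_⟩, ?_⟩
  · rw [div_lt_one h]; linarith [hy.2]
  · unfold branch; field_simp; ring

lemma interval_subset (hc : IsPartitionSeq c) (j : ℕ) :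
    Ioo (c (j + 1)) (c j) ⊆ Ioo (0 : ℝ) 1 :=
  Ioo_subset_Ioo (hc.pos _).le (hc.le_one _)

lemma image_subset (hc : IsPartitionSeq c) (j : ℕ) {A : Set ℝ} (hA : A ⊆ Ioo (0 : ℝ) 1) :
    branch c j '' A ⊆ Ioo (c (j + 1)) (c j) := by
  rintro _ ⟨x, hx, rfl⟩
  exact hc.branch_mem j (hA hx)

lemma image_subset_unit (hc : IsPartitionSeq c) (j : ℕ) {A : Set ℝ} (hA : A ⊆ Ioo (0 : ℝ) 1) :
    branch c j '' A ⊆ Ioo (0 : ℝ) 1 :=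
  (hc.image_subset j hA).trans (hc.interval_subset j)

lemma image_unit (hc : IsPartitionSeq c) (j : ℕ) :
    branch c j '' Ioo (0 : ℝ) 1 = Ioo (c (j + 1)) (c j) :=
  (hc.image_subset j subset_rfl).antisymm fun _ hy => hc.exists_branch_eq j hy

lemma eq_of_mem (hc : IsPartitionSeq c) {i j : ℕ} {x : ℝ} (hi : x ∈ Ioo (c (i + 1)) (c i))
    (hj : x ∈ Ioo (c (j + 1)) (c j)) : i = j := by
  by_contra h
  rcases Nat.lt_or_gt_of_ne h with h | h
  · have := hc.anti.antitone (Nat.succ_le_of_lt h)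
    linarith [hi.1, hj.2]
  · have := hc.anti.antitone (Nat.succ_le_of_lt h)
    linarith [hj.1, hi.2]

lemma disjoint_intervals (hc : IsPartitionSeq c) {i j : ℕ} (h : i ≠ j) :
    Disjoint (Ioo (c (i + 1)) (c i)) (Ioo (c (j + 1)) (c j)) :=
  Set.disjoint_left.2 fun _ hi hj => h (hc.eq_of_mem hi hj)

lemma exists_mem (hc : IsPartitionSeq c) {x : ℝ} (hx : x ∈ Ioo (0 : ℝ) 1) (hr : x ∉ range c) :
    ∃ j, x ∈ Ioo (c (j + 1)) (c j) := by
  classical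
  have hex : ∃ n, c n < x := ((hc.lim.eventually_lt_const hx.1)).exists
  obtain ⟨j, hj⟩ : ∃ j, Nat.find hex = j + 1 := by
    refine Nat.exists_eq_succ_of_ne_zero fun h => ?_
    have := Nat.find_spec hex
    rw [h, hc.zero] at this
    exact absurd hx.2 this.le.not_gt
  refine ⟨j, hj ▸ Nat.find_spec hex, ?_⟩
  have : ¬ c j < x := Nat.find_min hex (by omega)
  exact lt_of_le_of_ne (not_lt.1 this) fun h => hr ⟨j, h.symm⟩

lemma ae_notMem_range {μ : Measure ℝ} (hμ : μ ≪ volume) : ∀ᵐ x ∂μ, x ∉ range c :=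
  hμ (compl_mem_ae_iff.2 ((countable_range c).measure_zero volume))

lemma volume_image (hc : IsPartitionSeq c) (j : ℕ) (A : Set ℝ) :
    volume (branch c j '' A) = ENNReal.ofReal (c j - c (j + 1)) * volume A := by
  have : branch c j '' A = (fun x => c (j + 1) + x) '' ((fun x => (c j - c (j + 1)) • x) '' A) := by
    rw [Set.image_image]; rfl
  rw [this, Set.image_add_left, measure_preimage_add, Set.image_smul, Measure.addHaar_smul]
  simp [abs_of_pos (hc.len_pos j)]

lemma setIntegral_image (hc : IsPartitionSeq c) (j : ℕ) {A : Set ℝ} (hA : MeasurableSet A)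
    (g : ℝ → ℝ) :
    ∫ x in branch c j '' A, g x = ∫ x in A, (c j - c (j + 1)) * g (branch c j x) := by
  have := integral_image_eq_integral_abs_deriv_smul (f := branch c j)
    (f' := fun _ => c j - c (j + 1)) hA
    (fun x _ => by
      unfold branch
      simpa using (((hasDerivAt_id x).const_mul (c j - c (j + 1))).const_add
        (c (j + 1))).hasDerivWithinAt)
    ((hc.branch_injective j).injOn) g
  simpa [abs_of_pos (hc.len_pos j)] using this

/-- The set of points mapped into `A` by the full-branch affine map with inverse branches
`branch c k`. -/
lemma measurableSet_iUnion_image (hc : IsPartitionSeq c) {A : Set ℝ} (hA : MeasurableSet A) :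
    MeasurableSet (⋃ k, branch c k '' A) :=
  MeasurableSet.iUnion fun k => (hc.measurableEmbedding_branch k).measurableSet_image' hA

lemma pairwise_disjoint_image (hc : IsPartitionSeq c) {A : Set ℝ} (hA : A ⊆ Ioo (0 : ℝ) 1) :
    Pairwise (Function.onFun Disjoint fun k => branch c k '' A) := fun _ _ h =>
  (hc.disjoint_intervals h).mono (hc.image_subset _ hA) (hc.image_subset _ hA)

end IsPartitionSeq

/-- The transfer operator of the full-branch affine map. -/
noncomputable def transfer (c : ℕ → ℝ) (g : ℝ → ℝ) (x : ℝ) : ℝ :=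
  ∑' k, (c k - c (k + 1)) * g (branch c k x)

/-- `g` is bounded by `M` and `K`-Lipschitz. -/
structure IsBddLip (M K : ℝ) (g : ℝ → ℝ) : Prop where
  bound : ∀ x, |g x| ≤ M
  lip : ∀ x y, |g x - g y| ≤ K * |x - y|

namespace IsBddLip

variable {c : ℕ → ℝ} {M K : ℝ} {g : ℝ → ℝ}

lemma continuous (hg : IsBddLip M K g) : Continuous g := by
  have : LipschitzWith (Real.toNNReal K) g := LipschitzWith.of_dist_le' (by
    simpa [Real.dist_eq] using hg.lip)
  exact this.continuous

lemma summable (hc : IsPartitionSeq c) (hg : IsBddLip M K g) (x : ℝ) :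
    Summable fun k => (c k - c (k + 1)) * g (branch c k x) := by
  refine Summable.of_norm_bounded (hc.hasSum_len_zero.summable.mul_right M) fun k => ?_
  rw [norm_mul, Real.norm_of_nonneg (hc.len_pos k).le]
  exact mul_le_mul_of_nonneg_left (hg.bound _) (hc.len_pos k).le

lemma transfer (hc : IsPartitionSeq c) (hg : IsBddLip M K g) (hK : 0 ≤ K) {θ : ℝ}
    (hθ : ∀ k, c k - c (k + 1) ≤ θ) : IsBddLip M (θ * K) (transfer c g) := by
  constructor
  · intro x
    have h := hc.hasSum_len_zero.mul_right M
    rw [one_mul] at h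
    rw [← Real.norm_eq_abs]
    refine tsum_of_norm_bounded h fun k => ?_
    rw [norm_mul, Real.norm_of_nonneg (hc.len_pos k).le]
    exact mul_le_mul_of_nonneg_left (hg.bound _) (hc.len_pos k).le
  · intro x y
    unfold _root_.transfer
    rw [← (hg.summable hc x).tsum_sub (hg.summable hc y)]
    have h := hc.hasSum_len_zero.mul_right (θ * K * |x - y|)
    rw [one_mul] at h
    rw [← Real.norm_eq_abs]
    refine tsum_of_norm_bounded h fun k => ?_
    rw [← mul_sub, norm_mul, Real.norm_of_nonneg (hc.len_pos k).le]
    refine mul_le_mul_of_nonneg_left ((hg.lip _ _).trans ?_) (hc.len_pos k).le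
    have : branch c k x - branch c k y = (c k - c (k + 1)) * (x - y) := by unfold branch; ring
    rw [this, abs_mul, abs_of_pos (hc.len_pos k)]
    have := mul_le_mul_of_nonneg_right (hθ k) (mul_nonneg hK (abs_nonneg (x - y)))
    linarith

lemma setIntegral_transfer (hc : IsPartitionSeq c) (hg : IsBddLip M K g) {A : Set ℝ}
    (hA : MeasurableSet A) (hA' : A ⊆ Ioo (0 : ℝ) 1) :
    ∫ x in A, _root_.transfer c g x = ∫ x in ⋃ k, branch c k '' A, g x := by
  have hfin : ∀ B ⊆ Ioo (0 : ℝ) 1, volume B < ⊤ := fun B hB =>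
    (measure_mono hB).trans_lt (by simp)
  have hA1 : volume.real A ≤ 1 :=
    ENNReal.toReal_le_of_le_ofReal zero_le_one ((measure_mono hA').trans (by simp))
  have hM : 0 ≤ M := (abs_nonneg _).trans (hg.bound 0)
  have hbd : ∀ h : ℝ → ℝ, Continuous h → (∀ x, |h x| ≤ M) → ∀ B ⊆ Ioo (0 : ℝ) 1,
      IntegrableOn h B := fun h hh hhM B hB =>
    Measure.integrableOn_of_bounded (M := M) (hfin B hB).ne hh.aestronglyMeasurable
      (ae_of_all _ hhM)
  have hcomp : ∀ k, IntegrableOn (fun x => g (branch c k x)) A := fun k =>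
    hbd _ (hg.continuous.comp (by unfold branch; fun_prop)) (fun x => hg.bound _) A hA'
  rw [integral_iUnion (fun k => (hc.measurableEmbedding_branch k).measurableSet_image' hA)
    (hc.pairwise_disjoint_image hA')
    (hbd g hg.continuous hg.bound _ (iUnion_subset fun k => hc.image_subset_unit k hA'))]
  simp_rw [hc.setIntegral_image _ hA]
  refine (integral_tsum_of_summable_integral_norm
    (fun k => (hcomp k).const_mul (c k - c (k + 1))) ?_).symm
  refine Summable.of_nonneg_of_le (fun k => integral_nonneg fun _ => norm_nonneg _) (fun k => ?_)
    (hc.hasSum_len_zero.summable.mul_right M)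
  calc ∫ x in A, ‖(c k - c (k + 1)) * g (branch c k x)‖
      ≤ ‖∫ x in A, ‖(c k - c (k + 1)) * g (branch c k x)‖‖ := le_abs_self _
    _ ≤ (c k - c (k + 1)) * M * volume.real A := by
        refine norm_setIntegral_le_of_norm_le_const (hfin A hA') fun x _ => ?_
        rw [norm_norm, norm_mul, Real.norm_of_nonneg (hc.len_pos k).le]
        exact mul_le_mul_of_nonneg_left (hg.bound _) (hc.len_pos k).le
    _ ≤ _ := mul_le_of_le_one_right (mul_nonneg (hc.len_pos k).le hM) hA1

end IsBddLip

lemma exists_isBddLip_approx {m : Measure ℝ} [IsFiniteMeasure m] (hac : m ≪ volume)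
    {δ : ℝ} (hδ : 0 < δ) :
    ∃ M K g, 0 ≤ K ∧ IsBddLip M K g ∧
      ∀ A : Set ℝ, MeasurableSet A → volume A ≠ ⊤ → |m.real A - ∫ x in A, g x| ≤ δ := by
  set f : ℝ → ℝ := fun x => (m.rnDeriv volume x).toReal with hf
  have hfi : Integrable f volume := Measure.integrable_toReal_rnDeriv
  obtain ⟨g, hgs, hgc, hfg⟩ := (memLp_one_iff_integrable.2 hfi).exist_eLpNorm_sub_le
    ENNReal.one_ne_top le_rfl hδ
  obtain ⟨M, hM⟩ := hgs.exists_bound_of_continuous hgc.continuous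
  obtain ⟨K, hK⟩ := ContDiff.lipschitzWith_of_hasCompactSupport (𝕂 := ℝ) hgs hgc (by simp)
  refine ⟨M, K, g, K.2, ⟨hM, fun x y => ?_⟩, fun A hA hAt => ?_⟩
  · simpa [Real.dist_eq] using hK.dist_le_mul x y
  have hgi : Integrable g := hgc.continuous.integrable_of_hasCompactSupport hgs
  rw [← Measure.setIntegral_toReal_rnDeriv hac A, ← integral_sub hfi.integrableOn hgi.integrableOn]
  calc |∫ x in A, (f x - g x)| ≤ ∫ x in A, ‖f x - g x‖ := norm_integral_le_integral_norm (fun x => f x - g x)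
    _ ≤ ∫ x, ‖f x - g x‖ :=
        setIntegral_le_integral (hfi.sub hgi).norm (ae_of_all _ fun _ => norm_nonneg _)
    _ ≤ δ := by
        rw [integral_norm_eq_lintegral_enorm (f := fun x => f x - g x) (hfi.sub hgi).aestronglyMeasurable]
        refine ENNReal.toReal_le_of_le_ofReal hδ.le ?_
        rw [eLpNorm_one_eq_lintegral_enorm] at hfg
        exact hfg

/-- An absolutely continuous finite measure on `(0,1)` which is invariant under a full-branch
affine map is a multiple of Lebesgue measure. -/
theorem measure_eq_of_branch_invariant {c : ℕ → ℝ} (hc : IsPartitionSeq c) {m : Measure ℝ}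
    [IsFiniteMeasure m] (hac : m ≪ volume)
    (hinv : ∀ A : Set ℝ, MeasurableSet A → A ⊆ Ioo (0 : ℝ) 1 → m A = m (⋃ k, branch c k '' A))
    {A : Set ℝ} (hA : MeasurableSet A) (hA' : A ⊆ Ioo (0 : ℝ) 1) :
    m A = m (Ioo 0 1) * volume A := by
  obtain ⟨θ, hθ1, hθ⟩ : ∃ θ : ℝ, θ < 1 ∧ ∀ k, c k - c (k + 1) ≤ θ := by
    refine ⟨max (1 - c 1) (c 1), max_lt (by linarith [hc.pos 1]) ?_, fun k => ?_⟩
    · rw [← hc.zero]; exact hc.anti one_pos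
    · rcases k with _ | k
      · simp [hc.zero]
      · refine le_max_of_le_right ?_
        linarith [hc.pos (k + 1 + 1), hc.anti.antitone (show 1 ≤ k + 1 by omega)]
  have hθ0 : 0 ≤ θ := (hc.len_pos 0).le.trans (hθ 0)
  have hfin : ∀ B ⊆ Ioo (0 : ℝ) 1, volume B < ⊤ := fun B hB =>
    (measure_mono hB).trans_lt (by simp)
  have hA1 : volume.real A ≤ 1 :=
    ENNReal.toReal_le_of_le_ofReal zero_le_one ((measure_mono hA').trans (by simp))
  have key : ∀ δ > 0, |m.real A - m.real (Ioo 0 1) * volume.real A| ≤ 4 * δ := by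
    intro δ hδ
    obtain ⟨M, K, g, hK, hg, hm⟩ := exists_isBddLip_approx hac hδ
    have iter : ∀ n : ℕ, ∃ u : ℝ → ℝ, IsBddLip M (θ ^ n * K) u ∧ ∀ B : Set ℝ, MeasurableSet B →
        B ⊆ Ioo (0 : ℝ) 1 → |m.real B - ∫ x in B, u x| ≤ δ := by
      intro n
      induction n with
      | zero => exact ⟨g, by simpa using hg, fun B hB hB' => hm B hB (hfin B hB').ne⟩
      | succ n ih =>
        obtain ⟨u, hu, hmu⟩ := ih
        refine ⟨transfer c u, ?_, fun B hB hB' => ?_⟩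
        · have := hu.transfer hc (by positivity) hθ
          rwa [← mul_assoc, ← pow_succ'] at this
        · rw [hu.setIntegral_transfer hc hB hB', measureReal_def, hinv B hB hB',
            ← measureReal_def]
          exact hmu _ (hc.measurableSet_iUnion_image hB)
            (iUnion_subset fun k => hc.image_subset_unit k hB')
    obtain ⟨n, hn⟩ : ∃ n : ℕ, θ ^ n * K < δ := by
      have : Tendsto (fun n : ℕ => θ ^ n * K) atTop (𝓝 (0 * K)) :=
        (tendsto_pow_atTop_nhds_zero_of_lt_one hθ0 hθ1).mul_const K
      rw [zero_mul] at this
      exact (this.eventually_lt_const hδ).exists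
    obtain ⟨u, hu, hmu⟩ := iter n
    have hconst : ∀ B : Set ℝ, MeasurableSet B → B ⊆ Ioo (0 : ℝ) 1 →
        |m.real B - u 0 * volume.real B| ≤ 2 * δ := by
      intro B hB hB'
      have hB1 : volume.real B ≤ 1 :=
        ENNReal.toReal_le_of_le_ofReal zero_le_one ((measure_mono hB').trans (by simp))
      have hint : IntegrableOn u B := Measure.integrableOn_of_bounded (M := M) (hfin B hB').ne
        hu.continuous.aestronglyMeasurable (ae_of_all _ hu.bound)
      have h1 : |∫ x in B, (u x - u 0)| ≤ δ * volume.real B := by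
        rw [← Real.norm_eq_abs]
        refine norm_setIntegral_le_of_norm_le_const (hfin B hB') fun x hx => ?_
        refine (hu.lip x 0).trans ?_
        have := hB' hx
        rw [sub_zero, abs_of_pos this.1]
        have h0 : 0 ≤ θ ^ n * K := by positivity
        nlinarith [this.1, this.2]
      rw [integral_sub hint (integrableOn_const (hfin B hB').ne), setIntegral_const, smul_eq_mul]
        at h1
      have h2 := hmu B hB hB'
      rw [abs_le] at *
      constructor <;> nlinarith [h1.1, h1.2, h2.1, h2.2, measureReal_nonneg (μ := volume) (s := B)]
    have hU := hconst (Ioo 0 1) measurableSet_Ioo subset_rfl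
    have hAA := hconst A hA hA'
    have hv : volume.real (Ioo (0 : ℝ) 1) = 1 := by simp [measureReal_def]
    rw [hv, mul_one] at hU
    have h0 := measureReal_nonneg (μ := volume) (s := A)
    have hU' : |(m.real (Ioo 0 1) - u 0) * volume.real A| ≤ 2 * δ := by
      rw [abs_mul, abs_of_nonneg h0]
      exact (mul_le_of_le_one_right (abs_nonneg _) hA1).trans hU
    rw [abs_le] at *
    constructor <;> linarith [hAA.1, hAA.2, hU'.1, hU'.2]
  have h0 : m.real A = m.real (Ioo 0 1) * volume.real A := by
    refine sub_eq_zero.1 (abs_eq_zero.1 (le_antisymm ?_ (abs_nonneg _)))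
    refine le_of_forall_pos_le_add fun ε hε => ?_
    have := key (ε / 4) (by positivity)
    linarith
  rw [← ENNReal.toReal_eq_toReal_iff' (measure_ne_top _ _)
    (ENNReal.mul_ne_top (measure_ne_top _ _) (hfin A hA').ne), ENNReal.toReal_mul]
  exact h0

/-- `T` shifts the intervals of the partition affinely and maps the first one onto `(0,1)`. -/
structure IsShiftMap (c : ℕ → ℝ) (T : ℝ → ℝ) : Prop where
  zero : ∀ y ∈ Ioo (0 : ℝ) 1, T (branch c 0 y) = y
  succ : ∀ j, ∀ y ∈ Ioo (0 : ℝ) 1, T (branch c (j + 1) y) = branch c j y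

namespace IsShiftMap

variable {c : ℕ → ℝ} {T : ℝ → ℝ} {μ : Measure ℝ}

lemma ae_mem_branch (hc : IsPartitionSeq c) (hac : μ ≪ volume) (hμ : ∀ᵐ x ∂μ, x ∈ Ioo (0 : ℝ) 1) :
    ∀ᵐ x ∂μ, ∃ i, ∃ y ∈ Ioo (0 : ℝ) 1, branch c i y = x := by
  filter_upwards [hμ, IsPartitionSeq.ae_notMem_range (c := c) hac] with x hx hr
  obtain ⟨j, hj⟩ := hc.exists_mem hx hr
  exact ⟨j, hc.exists_branch_eq j hj⟩

lemma ae_mem_interval (hc : IsPartitionSeq c) (hac : μ ≪ volume)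
    (hμ : ∀ᵐ x ∂μ, x ∈ Ioo (0 : ℝ) 1) :
    ∀ᵐ x ∂μ, x ∈ ⋃ i, Ioo (c (i + 1)) (c i) := by
  filter_upwards [hμ, IsPartitionSeq.ae_notMem_range (c := c) hac] with x hx hr
  exact mem_iUnion.2 (hc.exists_mem hx hr)

lemma measure_eq_tsum (hc : IsPartitionSeq c) (hac : μ ≪ volume)
    (hμ : ∀ᵐ x ∂μ, x ∈ Ioo (0 : ℝ) 1) {E : Set ℝ} (hE : MeasurableSet E) :
    μ E = ∑' i, μ (E ∩ Ioo (c (i + 1)) (c i)) := by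
  rw [← measure_iUnion (fun i j h => (hc.disjoint_intervals h).mono inter_subset_right
    inter_subset_right) fun i => hE.inter measurableSet_Ioo]
  refine measure_congr ?_
  filter_upwards [ae_mem_interval hc hac hμ] with x hx
  obtain ⟨i, hi⟩ := mem_iUnion.1 hx
  exact propext ⟨fun h => mem_iUnion.2 ⟨i, h, hi⟩, fun h => (mem_iUnion.1 h).choose_spec.1⟩

lemma measure_image_branch_step (hc : IsPartitionSeq c) (hT : IsShiftMap c T)
    (hac : μ ≪ volume) (hμ : ∀ᵐ x ∂μ, x ∈ Ioo (0 : ℝ) 1) (hinv : MeasurePreserving T μ μ)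
    (j : ℕ) {A : Set ℝ} (hA : MeasurableSet A)
    (hA' : A ⊆ Ioo (0 : ℝ) 1) :
    μ (branch c j '' A) =
      μ (branch c (j + 1) '' A) + μ (branch c 0 '' (branch c j '' A)) := by
  have hE : MeasurableSet (branch c j '' A) :=
    (hc.measurableEmbedding_branch j).measurableSet_image' hA
  have hE' := hc.image_subset_unit j hA'
  rw [← hinv.measure_preimage hE.nullMeasurableSet, ← measure_union
    ((hc.disjoint_intervals (Nat.succ_ne_zero j)).mono (hc.image_subset _ hA')
      (hc.image_subset _ hE'))
    ((hc.measurableEmbedding_branch 0).measurableSet_image' hE)]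
  refine measure_congr ?_
  filter_upwards [ae_mem_branch hc hac hμ] with x hx
  obtain ⟨i, y, hy, rfl⟩ := hx
  refine propext ⟨fun h => ?_, fun h => ?_⟩
  · change T (branch c i y) ∈ branch c j '' A at h
    rcases i with _ | i
    · rw [hT.zero y hy] at h
      exact Or.inr ⟨y, h, rfl⟩
    · rw [hT.succ i y hy] at h
      have hij := hc.eq_of_mem (hc.branch_mem i hy) (hc.image_subset j hA' h)
      subst hij
      obtain ⟨a, ha, hay⟩ := h
      rw [hc.branch_injective i hay] at ha
      exact Or.inl ⟨y, ha, rfl⟩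
  · show T (branch c i y) ∈ branch c j '' A
    rcases h with ⟨a, ha, h⟩ | ⟨e, he, h⟩
    · rw [← h, hT.succ j a (hA' ha)]
      exact ⟨a, ha, rfl⟩
    · rw [← h, hT.zero e (hE' he)]
      exact he

lemma measure_image_branch_eq_tsum (hc : IsPartitionSeq c) (hT : IsShiftMap c T)
    (hac : μ ≪ volume) (hμ : ∀ᵐ x ∂μ, x ∈ Ioo (0 : ℝ) 1) (hinv : MeasurePreserving T μ μ)
    [IsFiniteMeasure μ] (j : ℕ) {A : Set ℝ}
    (hA : MeasurableSet A) (hA' : A ⊆ Ioo (0 : ℝ) 1) :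
    μ (branch c j '' A) = ∑' k, μ (branch c 0 '' (branch c (j + k) '' A)) := by
  have hfin : ∀ n, μ (branch c j '' A) =
      ∑ k ∈ Finset.range n, μ (branch c 0 '' (branch c (j + k) '' A)) +
        μ (branch c (j + n) '' A) := by
    intro n
    induction n with
    | zero => simp
    | succ n ih =>
      rw [ih, Finset.sum_range_succ, measure_image_branch_step hc hT hac hμ hinv (j + n) hA hA',
        add_assoc, add_assoc, add_comm (μ (branch c 0 '' _))]
  have hlim : Tendsto (fun n => μ (branch c (j + n) '' A)) atTop (𝓝 0) := by
    have : Tendsto (fun n => μ (branch c n '' A)) atTop (𝓝 0) := by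
      refine ENNReal.tendsto_atTop_zero_of_tsum_ne_top ?_
      rw [← measure_iUnion (hc.pairwise_disjoint_image hA')
        fun k => (hc.measurableEmbedding_branch k).measurableSet_image' hA]
      exact measure_ne_top _ _
    exact this.comp (tendsto_add_atTop_nat j |>.congr fun n => add_comm n j)
  have hsum := ENNReal.tendsto_nat_tsum fun k => μ (branch c 0 '' (branch c (j + k) '' A))
  have := hsum.add hlim
  rw [add_zero] at this
  refine tendsto_nhds_unique ?_ this
  simp_rw [← hfin]
  exact tendsto_const_nhds

lemma measure_image_zero (hc : IsPartitionSeq c) (hT : IsShiftMap c T)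
    (hac : μ ≪ volume) (hμ : ∀ᵐ x ∂μ, x ∈ Ioo (0 : ℝ) 1) (hinv : MeasurePreserving T μ μ)
    [IsFiniteMeasure μ] {A : Set ℝ}
    (hA : MeasurableSet A) (hA' : A ⊆ Ioo (0 : ℝ) 1) :
    μ (branch c 0 '' A) = μ (Ioo (c 1) (c 0)) * volume A := by
  have he := hc.measurableEmbedding_branch 0
  have hm : ∀ B, μ.comap (branch c 0) B = μ (branch c 0 '' B) := fun B => he.comap_apply μ B
  have hac' : μ.comap (branch c 0) ≪ volume := by
    refine Measure.AbsolutelyContinuous.mk fun B _ hB => ?_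
    rw [hm]
    exact hac (by rw [hc.volume_image, hB, mul_zero])
  have := measure_eq_of_branch_invariant hc hac' (fun B hB hB' => ?_) hA hA'
  · rwa [hm, hm, hc.image_unit] at this
  · rw [hm, hm, measure_image_branch_eq_tsum hc hT hac hμ hinv 0 hB hB', image_iUnion,
      measure_iUnion]
    · simp
    · exact fun i k h => (Set.disjoint_image_iff (hc.branch_injective 0)).2
        (hc.pairwise_disjoint_image hB' h)
    · exact fun i => he.measurableSet_image' ((hc.measurableEmbedding_branch i).measurableSet_image' hB)

lemma measure_image_branch (hc : IsPartitionSeq c) (hT : IsShiftMap c T)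
    (hac : μ ≪ volume) (hμ : ∀ᵐ x ∂μ, x ∈ Ioo (0 : ℝ) 1) (hinv : MeasurePreserving T μ μ)
    [IsFiniteMeasure μ] (j : ℕ) {A : Set ℝ}
    (hA : MeasurableSet A) (hA' : A ⊆ Ioo (0 : ℝ) 1) :
    μ (branch c j '' A) = μ (Ioo (c 1) (c 0)) * ENNReal.ofReal (c j) * volume A := by
  rw [measure_image_branch_eq_tsum hc hT hac hμ hinv j hA hA']
  have h : ∀ k, μ (branch c 0 '' (branch c (j + k) '' A)) = μ (Ioo (c 1) (c 0)) *
      ENNReal.ofReal (c (j + k) - c (j + k + 1)) * volume A := fun k => by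
    rw [measure_image_zero hc hT hac hμ hinv
      ((hc.measurableEmbedding_branch _).measurableSet_image' hA) (hc.image_subset_unit _ hA'),
      hc.volume_image, mul_assoc]
  simp_rw [h]
  rw [ENNReal.tsum_mul_right, ENNReal.tsum_mul_left,
    ← ENNReal.ofReal_tsum_of_nonneg (fun k => (hc.len_pos _).le) (hc.hasSum_len j).summable,
    (hc.hasSum_len j).tsum_eq]

/-- An absolutely continuous invariant measure has constant density on each interval of the
partition. -/
theorem measure_of_subset_interval (hc : IsPartitionSeq c) (hT : IsShiftMap c T)
    (hac : μ ≪ volume) (hμ : ∀ᵐ x ∂μ, x ∈ Ioo (0 : ℝ) 1) (hinv : MeasurePreserving T μ μ)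
    [IsFiniteMeasure μ] (j : ℕ) {E : Set ℝ} (hE : MeasurableSet E)
    (hE' : E ⊆ Ioo (c (j + 1)) (c j)) :
    μ E = μ (Ioo (c 1) (c 0)) * ENNReal.ofReal (c j / (c j - c (j + 1))) * volume E := by
  have he := hc.measurableEmbedding_branch j
  have hEA : E = branch c j '' (branch c j ⁻¹' E ∩ Ioo 0 1) := by
    rw [image_preimage_inter, hc.image_unit, inter_eq_left.2 hE']
  have hA : MeasurableSet (branch c j ⁻¹' E ∩ Ioo 0 1) :=
    (he.measurable hE).inter measurableSet_Ioo
  have hl := hc.len_pos j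
  rw [hEA, measure_image_branch hc hT hac hμ hinv j hA inter_subset_right, hc.volume_image,
    mul_assoc, mul_assoc]
  congr 1
  rw [← mul_assoc (ENNReal.ofReal _), ← ENNReal.ofReal_mul (div_nonneg (hc.pos j).le hl.le),
    div_mul_cancel₀ _ hl.ne']

lemma measure_first_interval_ne_zero (hc : IsPartitionSeq c) (hT : IsShiftMap c T)
    (hac : μ ≪ volume) (hμ : ∀ᵐ x ∂μ, x ∈ Ioo (0 : ℝ) 1) (hinv : MeasurePreserving T μ μ)
    [IsFiniteMeasure μ] (h0 : μ ≠ 0) :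
    μ (Ioo (c 1) (c 0)) ≠ 0 := by
  intro h
  refine h0 (Measure.measure_univ_eq_zero.1 ?_)
  rw [measure_eq_tsum hc hac hμ MeasurableSet.univ, ENNReal.tsum_eq_zero]
  intro i
  rw [univ_inter, measure_of_subset_interval hc hT hac hμ hinv i measurableSet_Ioo subset_rfl, h,
    zero_mul, zero_mul]

end IsShiftMap

/-- The measure on `(0,1)` with density `x ^ (-α)`. -/
noncomputable def powMeasure (α : ℝ) : Measure ℝ :=
  (volume.restrict (Ioo 0 1)).withDensity fun x => ENNReal.ofReal (x ^ (-α))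

lemma measurable_ofReal_rpow (s : ℝ) : Measurable fun x : ℝ => ENNReal.ofReal (x ^ s) := by
  fun_prop

lemma powMeasure_apply (α : ℝ) {E : Set ℝ} (hE : MeasurableSet E) :
    powMeasure α E = ∫⁻ x in E ∩ Ioo 0 1, ENNReal.ofReal (x ^ (-α)) := by
  rw [powMeasure, withDensity_apply _ hE, Measure.restrict_restrict hE]

lemma lintegral_rpow_Ioo {r s : ℝ} (hr : -1 < r) (hs : 0 < s) :
    ∫⁻ x in Ioo 0 s, ENNReal.ofReal (x ^ r) = ENNReal.ofReal (s ^ (r + 1) / (r + 1)) := by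
  rw [← ofReal_integral_eq_lintegral_ofReal]
  · rw [← integral_Ioc_eq_integral_Ioo, ← intervalIntegral.integral_of_le hs.le,
      integral_rpow (Or.inl hr), Real.zero_rpow (by linarith), sub_zero]
  · exact (intervalIntegral.integrableOn_Ioo_rpow_iff hs).2 hr
  · filter_upwards [ae_restrict_mem measurableSet_Ioo] with x hx
    exact Real.rpow_nonneg hx.1.le _

lemma powMeasure_le_of_subset {α s : ℝ} (hα0 : 0 ≤ α) (hs : 0 < s) {E : Set ℝ}
    (hE : MeasurableSet E) (hEs : E ⊆ Ici s) :
    powMeasure α E ≤ ENNReal.ofReal (s ^ (-α)) * volume E := by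
  rw [powMeasure_apply α hE]
  calc ∫⁻ x in E ∩ Ioo 0 1, ENNReal.ofReal (x ^ (-α))
      ≤ ∫⁻ x in E ∩ Ioo 0 1, ENNReal.ofReal (s ^ (-α)) := by
        refine setLIntegral_mono measurable_const fun x hx => ENNReal.ofReal_le_ofReal ?_
        exact Real.rpow_le_rpow_of_nonpos hs (hEs hx.1) (by linarith)
    _ ≤ _ := by
        rw [setLIntegral_const]
        gcongr
        exact inter_subset_left

lemma le_powMeasure_of_subset {α s : ℝ} (hα0 : 0 ≤ α) {E : Set ℝ}
    (hE : MeasurableSet E) (hEs : E ⊆ Iic s) (hE1 : E ⊆ Ioo 0 1) :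
    ENNReal.ofReal (s ^ (-α)) * volume E ≤ powMeasure α E := by
  rw [powMeasure_apply α hE, inter_eq_left.2 hE1, ← setLIntegral_const]
  refine setLIntegral_mono (measurable_ofReal_rpow _) fun x hx => ENNReal.ofReal_le_ofReal ?_
  exact Real.rpow_le_rpow_of_nonpos (hE1 hx).1 (hEs hx) (by linarith)

lemma powMeasure_ball_le {α : ℝ} (hα0 : 0 < α) (hα1 : α < 1) :
    ∃ κ > 0, ∀ x > 0, ∀ ε > 0,
      powMeasure α (Metric.ball x ε) ≤ ENNReal.ofReal (κ * (ε * (max x ε) ^ (-α))) := by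
  have h1α : 0 < 1 - α := by linarith
  have h3 : 0 ≤ (3 : ℝ) ^ (1 - α) / (1 - α) := by positivity
  refine ⟨2 ^ α * (2 + 3 ^ (1 - α) / (1 - α)), by positivity, fun x hx ε hε => ?_⟩
  have half : ∀ y : ℝ, 0 < y → (y / 2) ^ (-α) = 2 ^ α * y ^ (-α) := by
    intro y hy
    rw [Real.div_rpow hy.le zero_le_two, Real.rpow_neg zero_le_two, div_inv_eq_mul, mul_comm]
  have hm : 0 < max x ε := lt_max_of_lt_left hx
  have hmp : 0 ≤ 2 ^ α * (ε * (max x ε) ^ (-α)) := by positivity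
  rcases le_or_gt (2 * ε) x with h | h
  · refine (powMeasure_le_of_subset hα0.le (half_pos hx) Metric.isOpen_ball.measurableSet
      fun y hy => ?_).trans ?_
    · rw [Real.ball_eq_Ioo] at hy
      have := hy.1
      rw [mem_Ici]; linarith
    · rw [Real.volume_ball, ← ENNReal.ofReal_mul (by positivity)]
      refine ENNReal.ofReal_le_ofReal ?_
      rw [half x hx]
      rw [max_eq_left (by linarith)] at *
      nlinarith [mul_nonneg hmp h3]
  · have hsub : Metric.ball x ε ∩ Ioo 0 1 ⊆ Ioo 0 (3 * ε) := by
      rintro y ⟨hy, hy1⟩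
      rw [Real.ball_eq_Ioo] at hy
      exact ⟨hy1.1, by linarith [hy.2]⟩
    rw [powMeasure_apply α Metric.isOpen_ball.measurableSet]
    refine (lintegral_mono_set hsub).trans ?_
    rw [lintegral_rpow_Ioo (by linarith) (by positivity)]
    refine ENNReal.ofReal_le_ofReal ?_
    have e1 : (3 * ε) ^ (-α + 1) / (-α + 1) = 3 ^ (1 - α) / (1 - α) * (ε * ε ^ (-α)) := by
      rw [neg_add_eq_sub, Real.mul_rpow (by norm_num) hε.le, sub_eq_add_neg 1 α,
        Real.rpow_add hε, Real.rpow_one]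
      ring
    have e2 : ε ^ (-α) ≤ 2 ^ α * (max x ε) ^ (-α) := by
      rw [← half _ hm]
      refine Real.rpow_le_rpow_of_nonpos (half_pos hm) ?_ (by linarith)
      rw [div_le_iff₀ zero_lt_two]
      exact max_le (by linarith) (by linarith)
    rw [e1]
    have e3 := mul_le_mul_of_nonneg_left (mul_le_mul_of_nonneg_left e2 hε.le) h3
    nlinarith

/-- `μ` is comparable to the measure with density `x ^ (-α)` on `(0,1)`. -/
structure IsPowerLike (μ : Measure ℝ) (α a b : ℝ) : Prop where
  exponent_pos : 0 < α
  exponent_lt : α < 1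
  lower_pos : 0 < a
  upper_pos : 0 < b
  lower : ENNReal.ofReal a • powMeasure α ≤ μ
  upper : μ ≤ ENNReal.ofReal b • powMeasure α

namespace IsPowerLike

variable {μ : Measure ℝ} {α a b : ℝ}

lemma ae_mem (h : IsPowerLike μ α a b) : ∀ᵐ x ∂μ, x ∈ Ioo (0 : ℝ) 1 := by
  have h1 : μ ≪ powMeasure α :=
    (Measure.absolutelyContinuous_of_le h.upper).trans Measure.smul_absolutelyContinuous
  exact (h1.trans (withDensity_absolutelyContinuous _ _)) (ae_restrict_mem measurableSet_Ioo)

lemma le_measure (h : IsPowerLike μ α a b) {s : ℝ} {E : Set ℝ}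
    (hE : MeasurableSet E) (hEs : E ⊆ Iic s) (hE1 : E ⊆ Ioo 0 1) :
    ENNReal.ofReal (a * s ^ (-α)) * volume E ≤ μ E := by
  rw [ENNReal.ofReal_mul h.lower_pos.le, mul_assoc]
  refine le_trans ?_ (h.lower E)
  rw [Measure.smul_apply, smul_eq_mul]
  gcongr
  exact le_powMeasure_of_subset h.exponent_pos.le hE hEs hE1

lemma le_measure_Ioo (h : IsPowerLike μ α a b) {u v : ℝ} (hu : 0 ≤ u) (hv : v ≤ 1) :
    ENNReal.ofReal (a * (v - u)) ≤ μ (Ioo u v) := by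
  have := h.le_measure (E := Ioo u v) measurableSet_Ioo (fun x hx => hx.2.le.trans hv)
    (Ioo_subset_Ioo hu hv)
  rwa [Real.one_rpow, mul_one, Real.volume_Ioo, ← ENNReal.ofReal_mul h.lower_pos.le] at this

lemma le_ball (h : IsPowerLike μ α a b) {x ε : ℝ} (hx : x ∈ Ioo (0 : ℝ) 1) (hε : ε < 1 / 2) :
    ENNReal.ofReal (a * ε) ≤ μ (Metric.ball x ε) := by
  rcases le_total x (1 / 2) with hx2 | hx2
  · have := h.le_measure_Ioo (u := x) (v := x + ε) hx.1.le (by linarith)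
    rw [add_sub_cancel_left] at this
    refine this.trans (measure_mono ?_)
    rw [Real.ball_eq_Ioo]
    exact fun y hy => ⟨by linarith [hy.1, hy.2], hy.2⟩
  · have := h.le_measure_Ioo (u := x - ε) (v := x) (by linarith) hx.2.le
    rw [sub_sub_cancel] at this
    refine this.trans (measure_mono ?_)
    rw [Real.ball_eq_Ioo]
    exact fun y hy => ⟨hy.1, by linarith [hy.1, hy.2]⟩

lemma le_measure_initial (h : IsPowerLike μ α a b) {ε : ℝ} (hε0 : 0 < ε) (hε : ε < 1) :
    ENNReal.ofReal (a * ε ^ (1 - α)) ≤ μ (Ioo 0 ε) := by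
  have := h.le_measure (E := Ioo 0 ε) measurableSet_Ioo (fun x hx => hx.2.le)
    (Ioo_subset_Ioo le_rfl hε.le)
  rwa [Real.volume_Ioo, ← ENNReal.ofReal_mul (by have := h.lower_pos; positivity), sub_zero,
    mul_assoc, mul_comm (ε ^ (-α)), ← Real.rpow_one_add' hε0.le (by linarith [h.exponent_lt]),
    ← sub_eq_add_neg] at this

lemma ball_le (h : IsPowerLike μ α a b) : ∃ κ > 0, ∀ x > 0, ∀ ε > 0, ∀ t ∈ Icc (0 : ℝ) 1,
    μ (Metric.ball x ε) ≤ ENNReal.ofReal (κ * (ε ^ (1 - α + α * t) * x ^ (-(α * t)))) := by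
  obtain ⟨κ, hκ, hb⟩ := powMeasure_ball_le h.exponent_pos h.exponent_lt
  have h0 := h.exponent_pos
  refine ⟨b * κ, mul_pos h.upper_pos hκ, fun x hx ε hε t ht => (h.upper _).trans ?_⟩
  rw [Measure.smul_apply, smul_eq_mul, mul_assoc, ENNReal.ofReal_mul h.upper_pos.le]
  gcongr
  refine (hb x hx ε hε).trans (ENNReal.ofReal_le_ofReal ?_)
  have hm : 0 < max x ε := lt_max_of_lt_left hx
  refine mul_le_mul_of_nonneg_left ?_ hκ.le
  have e1 : max x ε ^ (-α) = max x ε ^ (-(α * t)) * max x ε ^ (-(α * (1 - t))) := by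
    rw [← Real.rpow_add hm]; ring_nf
  have e2 : ε ^ (1 - α + α * t) = ε * ε ^ (-(α * (1 - t))) := by
    rw [show 1 - α + α * t = 1 + -(α * (1 - t)) by ring, Real.rpow_add hε, Real.rpow_one]
  rw [e1, e2, mul_assoc, mul_comm (max x ε ^ (-(α * t)))]
  have h2 : 0 ≤ α * (1 - t) := mul_nonneg h0.le (by linarith [ht.2])
  have h3 : 0 ≤ α * t := mul_nonneg h0.le ht.1
  gcongr ?_ * (?_ * ?_)
  · exact Real.rpow_le_rpow_of_nonpos hε (le_max_right _ _) (by linarith)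
  · exact Real.rpow_le_rpow_of_nonpos hx (le_max_left _ _) (by linarith)

lemma lintegral_rpow_le (h : IsPowerLike μ α a b) {s : ℝ} (hs : s + α < 1) :
    ∫⁻ x, ENNReal.ofReal (x ^ (-s)) ∂μ ≤ ENNReal.ofReal (b / (1 - s - α)) := by
  calc ∫⁻ x, ENNReal.ofReal (x ^ (-s)) ∂μ
      ≤ ∫⁻ x, ENNReal.ofReal (x ^ (-s)) ∂(ENNReal.ofReal b • powMeasure α) :=
        lintegral_mono' h.upper le_rfl
    _ = ENNReal.ofReal b * ∫⁻ x in Ioo 0 1, ENNReal.ofReal (x ^ (-α - s)) := by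
        rw [lintegral_smul_measure, smul_eq_mul, powMeasure,
          lintegral_withDensity_eq_lintegral_mul _ (measurable_ofReal_rpow _)
            (measurable_ofReal_rpow _)]
        congr 1
        refine setLIntegral_congr_fun measurableSet_Ioo fun x hx => ?_
        rw [Pi.mul_apply, ← ENNReal.ofReal_mul (Real.rpow_nonneg hx.1.le _),
          ← Real.rpow_add hx.1, ← sub_eq_add_neg]
    _ = _ := by
        rw [lintegral_rpow_Ioo (by linarith) one_pos, Real.one_rpow,
          ← ENNReal.ofReal_mul h.upper_pos.le]
        congr 1
        rw [show -α - s + 1 = 1 - s - α by ring, mul_one_div]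

end IsPowerLike

lemma ENNReal.rpow_le_rpow_of_exponent_nonpos {x y : ℝ≥0∞} {z : ℝ} (h : x ≤ y) (hz : z ≤ 0) :
    y ^ z ≤ x ^ z := by
  rw [← neg_neg z, ENNReal.rpow_neg y, ENNReal.rpow_neg x, ENNReal.inv_le_inv]
  exact ENNReal.rpow_le_rpow h (by linarith)

lemma eventually_mem_Ioo_zero {δ : ℝ} (hδ : 0 < δ) : ∀ᶠ ε : ℝ in 𝓝[>] 0, ε ∈ Ioo 0 δ :=
  Ioo_mem_nhdsGT hδ

/-- If `e log ε + A ≤ f ε ≤ (e - η) log ε + B η` for every `η > 0`, then `f ε / log ε → e`. -/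
lemma tendsto_div_log {f : ℝ → ℝ} {e A : ℝ}
    (hlow : ∀ᶠ ε in 𝓝[>] (0 : ℝ), A + e * Real.log ε ≤ f ε)
    (hup : ∀ η > 0, ∃ B, ∀ᶠ ε in 𝓝[>] (0 : ℝ), f ε ≤ B + (e - η) * Real.log ε) :
    Tendsto (fun ε => f ε / Real.log ε) (𝓝[>] 0) (𝓝 e) := by
  have hlog := Real.tendsto_log_nhdsGT_zero
  have hconst : ∀ A : ℝ, Tendsto (fun ε : ℝ => A / Real.log ε) (𝓝[>] 0) (𝓝 0) := fun A =>
    tendsto_const_nhds.div_atBot hlog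
  rw [tendsto_order]
  constructor
  · intro u hu
    obtain ⟨B, hB⟩ := hup ((e - u) / 2) (by linarith)
    filter_upwards [hB, hlog.eventually_lt_atBot 0,
      (hconst B).eventually (lt_mem_nhds (show -((e - u) / 2) < 0 by linarith))] with ε h1 h2 h3
    have : B / Real.log ε + (e - (e - u) / 2) ≤ f ε / Real.log ε := by
      rw [div_add' _ _ _ h2.ne]
      exact div_le_div_of_nonpos_of_le h2.le h1
    linarith
  · intro u hu
    filter_upwards [hlow, hlog.eventually_lt_atBot 0,
      (hconst A).eventually (gt_mem_nhds (show 0 < u - e by linarith))] with ε h1 h2 h3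
    have : f ε / Real.log ε ≤ A / Real.log ε + e := by
      rw [div_add' _ _ _ h2.ne]
      exact div_le_div_of_nonpos_of_le h2.le h1
    linarith

lemma tendsto_dimScale_s19 {F : ℝ → ℝ≥0∞} {q D e A : ℝ} (hq : q ≠ 1) (he : e = (q - 1) * D)
    (hA : 0 < A) (hlow : ∀ᶠ ε in 𝓝[>] (0 : ℝ), ENNReal.ofReal (A * ε ^ e) ≤ F ε)
    (hup : ∀ η > 0, ∃ B > 0, ∀ᶠ ε in 𝓝[>] (0 : ℝ), F ε ≤ ENNReal.ofReal (B * ε ^ (e - η))) :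
    Tendsto (dimScale F q) (𝓝[>] 0) (𝓝 (D : EReal)) := by
  have hq' : q - 1 ≠ 0 := sub_ne_zero.2 hq
  have hpos : ∀ᶠ ε : ℝ in 𝓝[>] 0, 0 < ε := self_mem_nhdsWithin
  have htop : ∀ᶠ ε in 𝓝[>] (0 : ℝ), F ε ≠ ⊤ := by
    obtain ⟨B, _, h⟩ := hup 1 one_pos
    filter_upwards [h] with ε h
    exact (h.trans_lt ENNReal.ofReal_lt_top).ne
  have hzero : ∀ᶠ ε in 𝓝[>] (0 : ℝ), F ε ≠ 0 := by
    filter_upwards [hlow, hpos] with ε h h0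
    exact ((ENNReal.ofReal_pos.2 (by positivity)).trans_le h).ne'
  have key : Tendsto (fun ε => Real.log (F ε).toReal / Real.log ε) (𝓝[>] 0) (𝓝 e) := by
    refine tendsto_div_log (A := Real.log A) ?_ fun η hη => ?_
    · filter_upwards [hlow, htop, hpos] with ε h1 h2 h3
      rw [← Real.log_rpow h3, ← Real.log_mul hA.ne' (by positivity)]
      exact Real.log_le_log (by positivity) ((ENNReal.ofReal_le_iff_le_toReal h2).1 h1)
    · obtain ⟨B, hB, h⟩ := hup η hη
      refine ⟨Real.log B, ?_⟩
      filter_upwards [h, hzero, htop, hpos] with ε h1 h2 h4 h3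
      rw [← Real.log_rpow h3, ← Real.log_mul hB.ne' (by positivity)]
      exact Real.log_le_log (ENNReal.toReal_pos h2 h4)
        (ENNReal.toReal_le_of_le_ofReal (by positivity) h1)
  have key2 := (continuous_coe_real_ereal.tendsto _).comp (key.const_mul (q - 1)⁻¹)
  rw [he, inv_mul_cancel_left₀ hq'] at key2
  refine key2.congr' ?_
  filter_upwards [hzero, htop] with ε h1 h2
  rw [dimScale, elog, if_neg h1, if_neg h2, ← EReal.coe_mul, Function.comp_apply]
  congr 1
  rw [mul_inv, div_eq_inv_mul, mul_assoc]

lemma dim_eq_of_tendsto {F : ℝ → ℝ≥0∞} {Flog : ℝ → ℝ} {q : ℝ} {D : EReal} (hq : q ≠ 1)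
    (h : Tendsto (dimScale F q) (𝓝[>] 0) (𝓝 D)) :
    dimPlus F Flog q = D ∧ dimMinus F Flog q = D := by
  simp only [dimPlus, dimMinus, if_neg hq]
  exact ⟨h.limsup_eq, h.liminf_eq⟩

namespace IsPowerLike

variable {μ : Measure ℝ} {α a b : ℝ}

lemma tendsto_dimScale_of_lt_one [IsProbabilityMeasure μ] (h : IsPowerLike μ α a b) {q : ℝ}
    (hq : q < 1) :
    Tendsto (dimScale (fun ε => measPF μ ε q) q) (𝓝[>] 0) (𝓝 ((1 : ℝ) : EReal)) := by
  have ha := h.lower_pos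
  obtain ⟨κ, hκ, hb⟩ := h.ball_le
  have hα := h.exponent_pos
  refine tendsto_dimScale_s19 (e := q - 1)
    (A := (κ * 2 ^ α) ^ (q - 1) * (a * (1 - 1 / 2))) hq.ne (by ring) (by positivity) ?_ ?_
  · filter_upwards [eventually_mem_Ioo_zero one_pos] with ε hε
    have hε0 := hε.1
    rw [mul_right_comm, ← Real.mul_rpow (by positivity) hε0.le,
      ENNReal.ofReal_mul (by positivity), ← ENNReal.ofReal_rpow_of_pos (by positivity)]
    calc ENNReal.ofReal (κ * 2 ^ α * ε) ^ (q - 1) * ENNReal.ofReal (a * (1 - 1 / 2))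
        ≤ ENNReal.ofReal (κ * 2 ^ α * ε) ^ (q - 1) * μ (Ioo (1 / 2) 1) := by
          gcongr
          exact h.le_measure_Ioo (by norm_num) le_rfl
      _ = ∫⁻ _ in Ioo (1 / 2) 1, ENNReal.ofReal (κ * 2 ^ α * ε) ^ (q - 1) ∂μ := by
          rw [setLIntegral_const]
      _ ≤ ∫⁻ x in Ioo (1 / 2) 1, μ (Metric.ball x ε) ^ (q - 1) ∂μ := by
          refine setLIntegral_mono' measurableSet_Ioo fun x hx => ?_
          refine ENNReal.rpow_le_rpow_of_exponent_nonpos ?_ (by linarith)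
          have hx0 : 0 < x := by linarith [hx.1]
          refine (hb x hx0 ε hε0 1 ⟨zero_le_one, le_rfl⟩).trans (ENNReal.ofReal_le_ofReal ?_)
          rw [mul_one, sub_add_cancel, Real.rpow_one, mul_assoc, mul_comm ε]
          gcongr
          have := Real.rpow_le_rpow_of_nonpos (z := -α) (show (0 : ℝ) < 1 / 2 by norm_num) hx.1.le
            (by linarith)
          rwa [one_div, Real.inv_rpow zero_le_two, Real.rpow_neg zero_le_two, inv_inv] at this
      _ ≤ measPF μ ε q := setLIntegral_le_lintegral _ _
  · intro η hη
    refine ⟨a ^ (q - 1), by positivity, ?_⟩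
    filter_upwards [eventually_mem_Ioo_zero (δ := 1 / 2) (by norm_num)] with ε hε
    have hε0 := hε.1
    calc measPF μ ε q ≤ ∫⁻ _, ENNReal.ofReal (a * ε) ^ (q - 1) ∂μ := by
          refine lintegral_mono_ae ?_
          filter_upwards [h.ae_mem] with x hx
          exact ENNReal.rpow_le_rpow_of_exponent_nonpos (h.le_ball hx hε.2) (by linarith)
      _ = ENNReal.ofReal (a * ε) ^ (q - 1) := by simp
      _ ≤ _ := by
          rw [ENNReal.ofReal_rpow_of_pos (by positivity), Real.mul_rpow ha.le hε0.le]
          refine ENNReal.ofReal_le_ofReal (mul_le_mul_of_nonneg_left ?_ (by positivity))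
          exact Real.rpow_le_rpow_of_exponent_ge hε0 (by linarith [hε.2]) (by linarith)

/-- The lower bound for the partition function coming from typical points. -/
lemma le_measPF_typical [IsProbabilityMeasure μ] (h : IsPowerLike μ α a b) {q ε : ℝ}
    (hq : 1 < q) (hε0 : 0 < ε) (hε : ε < 1 / 2) :
    ENNReal.ofReal (a ^ (q - 1) * ε ^ (q - 1)) ≤ measPF μ ε q := by
  have ha := h.lower_pos
  calc ENNReal.ofReal (a ^ (q - 1) * ε ^ (q - 1))
      = ∫⁻ _, ENNReal.ofReal (a * ε) ^ (q - 1) ∂μ := by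
        rw [ENNReal.ofReal_rpow_of_pos (by positivity), Real.mul_rpow ha.le hε0.le]; simp
    _ ≤ measPF μ ε q := by
        refine lintegral_mono_ae ?_
        filter_upwards [h.ae_mem] with x hx
        exact ENNReal.rpow_le_rpow (h.le_ball hx hε) (by linarith)

/-- The lower bound for the partition function coming from the singularity of the density. -/
lemma le_measPF_singular (h : IsPowerLike μ α a b) {q ε : ℝ}
    (hq : 1 < q) (hε0 : 0 < ε) (hε : ε < 1) :
    ENNReal.ofReal (a ^ q * ε ^ ((1 - α) * q)) ≤ measPF μ ε q := by
  have ha := h.lower_pos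
  have hpos : 0 < a * ε ^ (1 - α) := by positivity
  calc ENNReal.ofReal (a ^ q * ε ^ ((1 - α) * q))
      = ENNReal.ofReal (a * ε ^ (1 - α)) ^ (q - 1) * ENNReal.ofReal (a * ε ^ (1 - α)) := by
        rw [ENNReal.ofReal_rpow_of_pos hpos, ← ENNReal.ofReal_mul (by positivity),
          ← Real.rpow_add_one hpos.ne', sub_add_cancel, Real.mul_rpow ha.le (by positivity),
          ← Real.rpow_mul hε0.le]
    _ ≤ ENNReal.ofReal (a * ε ^ (1 - α)) ^ (q - 1) * μ (Ioo 0 ε) := by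
        gcongr
        exact h.le_measure_initial hε0 hε
    _ = ∫⁻ _ in Ioo 0 ε, ENNReal.ofReal (a * ε ^ (1 - α)) ^ (q - 1) ∂μ := by
        rw [setLIntegral_const]
    _ ≤ ∫⁻ x in Ioo 0 ε, μ (Metric.ball x ε) ^ (q - 1) ∂μ := by
        refine setLIntegral_mono' measurableSet_Ioo fun x hx => ?_
        refine ENNReal.rpow_le_rpow ((h.le_measure_initial hε0 hε).trans (measure_mono ?_))
          (by linarith)
        rw [Real.ball_eq_Ioo]
        exact Ioo_subset_Ioo (by linarith [hx.2]) (by linarith [hx.1])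
    _ ≤ measPF μ ε q := setLIntegral_le_lintegral _ _

lemma measPF_le (h : IsPowerLike μ α a b) {q t : ℝ} (hq : 1 < q) (ht : t ∈ Icc (0 : ℝ) 1)
    (htα : α * t * (q - 1) + α < 1) :
    ∃ B > 0, ∀ ε > 0, measPF μ ε q ≤ ENNReal.ofReal (B * ε ^ ((q - 1) * (1 - α + α * t))) := by
  obtain ⟨κ, hκ, hb⟩ := h.ball_le
  have hb0 := h.upper_pos
  have hd : 0 < 1 - α * t * (q - 1) - α := by linarith
  refine ⟨κ ^ (q - 1) * (b / (1 - α * t * (q - 1) - α)), by positivity, fun ε hε => ?_⟩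
  calc measPF μ ε q
      ≤ ∫⁻ x, ENNReal.ofReal (κ ^ (q - 1) * ε ^ ((q - 1) * (1 - α + α * t))) *
          ENNReal.ofReal (x ^ (-(α * t * (q - 1)))) ∂μ := by
        refine lintegral_mono_ae ?_
        filter_upwards [h.ae_mem] with x hx
        have hx0 := hx.1
        refine (ENNReal.rpow_le_rpow (hb x hx0 ε hε t ht) (by linarith)).trans_eq ?_
        rw [ENNReal.ofReal_rpow_of_pos (by positivity), ← ENNReal.ofReal_mul (by positivity),
          Real.mul_rpow hκ.le (by positivity), Real.mul_rpow (by positivity) (by positivity),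
          ← Real.rpow_mul hε.le, ← Real.rpow_mul hx0.le, mul_comm (q - 1), neg_mul, ← mul_assoc]
    _ = ENNReal.ofReal (κ ^ (q - 1) * ε ^ ((q - 1) * (1 - α + α * t))) *
          ∫⁻ x, ENNReal.ofReal (x ^ (-(α * t * (q - 1)))) ∂μ :=
        lintegral_const_mul _ (measurable_ofReal_rpow _)
    _ ≤ ENNReal.ofReal (κ ^ (q - 1) * ε ^ ((q - 1) * (1 - α + α * t))) *
          ENNReal.ofReal (b / (1 - α * t * (q - 1) - α)) := by
        gcongr
        exact h.lintegral_rpow_le htα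
    _ = _ := by
        rw [← ENNReal.ofReal_mul (by positivity)]
        congr 1
        ring

/-- The upper bound for the partition function, up to an arbitrarily small loss in the exponent;
`s` is the critical exponent of interpolation. -/
lemma measPF_le_of_critical (h : IsPowerLike μ α a b) {q s e : ℝ} (hq : 1 < q)
    (hs : s ∈ Ioc (0 : ℝ) 1) (hsα : α * s * (q - 1) + α ≤ 1)
    (he : e = (q - 1) * (1 - α + α * s)) {η : ℝ} (hη : 0 < η) :
    ∃ B > 0, ∀ᶠ ε in 𝓝[>] (0 : ℝ), measPF μ ε q ≤ ENNReal.ofReal (B * ε ^ (e - η)) := by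
  have hα := h.exponent_pos
  have hk : 0 < (q - 1) * α := mul_pos (by linarith) hα
  set t := max 0 (s - η / ((q - 1) * α)) with ht
  have hts : t < s := max_lt hs.1 (sub_lt_self _ (by positivity))
  have ht0 : 0 ≤ t := le_max_left _ _
  obtain ⟨B, hB, hle⟩ := h.measPF_le (t := t) hq ⟨ht0, hts.le.trans hs.2⟩
    (by nlinarith)
  refine ⟨B, hB, ?_⟩
  filter_upwards [eventually_mem_Ioo_zero one_pos] with ε hε
  refine (hle ε hε.1).trans (ENNReal.ofReal_le_ofReal (mul_le_mul_of_nonneg_left ?_ hB.le))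
  refine Real.rpow_le_rpow_of_exponent_ge hε.1 hε.2.le ?_
  have h1 : s - η / ((q - 1) * α) ≤ t := le_max_right _ _
  have h2 := mul_le_mul_of_nonneg_left h1 hk.le
  rw [mul_sub, mul_div_cancel₀ _ hk.ne'] at h2
  rw [he]
  linarith

lemma tendsto_dimScale_of_le [IsProbabilityMeasure μ] (h : IsPowerLike μ α a b) {q : ℝ}
    (hq : 1 < q) (hqα : α * q ≤ 1) :
    Tendsto (dimScale (fun ε => measPF μ ε q) q) (𝓝[>] 0) (𝓝 ((1 : ℝ) : EReal)) := by
  have ha := h.lower_pos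
  refine tendsto_dimScale_s19 (e := q - 1) (A := a ^ (q - 1)) hq.ne' (by ring) (by positivity) ?_
    fun η hη => h.measPF_le_of_critical hq (s := 1) ⟨one_pos, le_rfl⟩ (by linarith) (by ring) hη
  filter_upwards [eventually_mem_Ioo_zero (δ := 1 / 2) (by norm_num)] with ε hε
  exact h.le_measPF_typical hq hε.1 hε.2

lemma tendsto_dimScale_of_ge (h : IsPowerLike μ α a b) {q : ℝ} (hqα : 1 ≤ α * q) :
    Tendsto (dimScale (fun ε => measPF μ ε q) q) (𝓝[>] 0)
      (𝓝 (((1 - α) * (q / (q - 1)) : ℝ) : EReal)) := by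
  have ha := h.lower_pos
  have hα := h.exponent_pos
  have hα1 := h.exponent_lt
  have hq : 1 < q := by nlinarith
  have hq1 : 0 < q - 1 := by linarith
  have hs : 0 < α * (q - 1) := by positivity
  refine tendsto_dimScale_s19 (e := (1 - α) * q) (A := a ^ q) hq.ne' (by field_simp) (by positivity) ?_
    fun η hη => h.measPF_le_of_critical hq (s := (1 - α) / (α * (q - 1)))
      ⟨div_pos (by linarith) hs, ?_⟩ ?_ ?_ hη
  · filter_upwards [eventually_mem_Ioo_zero one_pos] with ε hε
    exact h.le_measPF_singular hq hε.1 hε.2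
  · rw [div_le_one hs]; linarith
  · refine le_of_eq ?_
    field_simp
    ring
  · field_simp
    ring

lemma measurable_measure_ball [SFinite μ] (ε : ℝ) : Measurable fun x => μ (Metric.ball x ε) := by
  have hs : MeasurableSet {z : ℝ × ℝ | dist z.2 z.1 < ε} :=
    measurableSet_lt (by fun_prop) measurable_const
  exact measurable_measure_prodMk_left hs

lemma integrable_rpow (h : IsPowerLike μ α a b) {s : ℝ} (hs : s + α < 1) :
    Integrable (fun x => x ^ (-s)) μ := by
  refine ⟨by fun_prop, ?_⟩
  rw [hasFiniteIntegral_iff_norm]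
  refine lt_of_le_of_lt ?_ (h.lintegral_rpow_le hs |>.trans_lt ENNReal.ofReal_lt_top)
  refine lintegral_mono_ae ?_
  filter_upwards [h.ae_mem] with x hx
  rw [Real.norm_of_nonneg (Real.rpow_nonneg hx.1.le _)]

lemma tendsto_measPFlog [IsProbabilityMeasure μ] (h : IsPowerLike μ α a b) :
    Tendsto (fun ε => measPFlog μ ε / Real.log ε) (𝓝[>] 0) (𝓝 1) := by
  have ha := h.lower_pos
  have hα := h.exponent_pos
  have hα1 := h.exponent_lt
  obtain ⟨κ, hκ, hb⟩ := h.ball_le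
  set s := (1 - α) / 2 with hs
  have hs0 : 0 < s := by linarith
  have hsi := h.integrable_rpow (s := s) (by linarith)
  have hlow : ∀ ε ∈ Ioo (0 : ℝ) (1 / 2), ∀ᵐ x ∂μ,
      Real.log a + Real.log ε ≤ Real.log (μ (Metric.ball x ε)).toReal := by
    intro ε hε
    have hε0 := hε.1
    filter_upwards [h.ae_mem] with x hx
    rw [← Real.log_mul ha.ne' hε0.ne']
    exact Real.log_le_log (by positivity)
      ((ENNReal.ofReal_le_iff_le_toReal (measure_ne_top _ _)).1 (h.le_ball hx hε.2))
  have hup : ∀ ε ∈ Ioo (0 : ℝ) (1 / 2), ∀ᵐ x ∂μ,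
      Real.log (μ (Metric.ball x ε)).toReal ≤
        Real.log κ + Real.log ε + α * (x ^ (-s) / s) := by
    intro ε hε
    have hε0 := hε.1
    filter_upwards [h.ae_mem] with x hx
    have hx0 := hx.1
    have h1 := hb x hx0 ε hε0 1 ⟨zero_le_one, le_rfl⟩
    rw [mul_one, sub_add_cancel, Real.rpow_one] at h1
    have h2 := Real.log_le_log (ENNReal.toReal_pos
      ((ENNReal.ofReal_pos.2 (by positivity)).trans_le (h.le_ball hx hε.2)).ne'
        (measure_ne_top _ _))
      (ENNReal.toReal_le_of_le_ofReal (by positivity) h1)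
    rw [Real.log_mul hκ.ne' (by positivity), Real.log_mul hε0.ne' (by positivity),
      Real.log_rpow hx0] at h2
    have h3 := Real.log_le_rpow_div (inv_nonneg.2 hx0.le) hs0
    rw [Real.log_inv, Real.inv_rpow hx0.le, ← Real.rpow_neg hx0.le] at h3
    have h4 := mul_le_mul_of_nonneg_left h3 hα.le
    linarith
  have hint : ∀ ε ∈ Ioo (0 : ℝ) (1 / 2),
      Integrable (fun x => Real.log (μ (Metric.ball x ε)).toReal) μ := by
    intro ε hε
    refine Integrable.of_bound (C := |Real.log a + Real.log ε|)
      (measurable_measure_ball ε).ennreal_toReal.log.aestronglyMeasurable ?_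
    filter_upwards [hlow ε hε] with x hx
    have h1 : Real.log (μ (Metric.ball x ε)).toReal ≤ 0 :=
      Real.log_nonpos ENNReal.toReal_nonneg measureReal_le_one
    rw [Real.norm_eq_abs]
    exact abs_le_abs_of_nonpos h1 hx
  have hui : ∀ ε : ℝ, Integrable (fun x => Real.log κ + Real.log ε + α * (x ^ (-s) / s)) μ :=
    fun ε => (integrable_const _).add ((hsi.div_const s).const_mul α)
  refine tendsto_div_log (A := Real.log a) ?_ fun η hη =>
    ⟨Real.log κ + ∫ x, α * (x ^ (-s) / s) ∂μ, ?_⟩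
  · filter_upwards [eventually_mem_Ioo_zero (δ := 1 / 2) (by norm_num)] with ε hε
    have := integral_mono_ae (integrable_const _) (hint ε hε) (hlow ε hε)
    rw [integral_const, probReal_univ, one_smul] at this
    rwa [one_mul]
  · filter_upwards [eventually_mem_Ioo_zero (δ := 1 / 2) (by norm_num)] with ε hε
    have := integral_mono_ae (hint ε hε) (hui ε) (hup ε hε)
    rw [integral_add (integrable_const _) ((hsi.div_const s).const_mul α), integral_const,
      probReal_univ, one_smul] at this
    have hl : Real.log ε < 0 := Real.log_neg hε.1 (by linarith [hε.2])
    have h2 : measPFlog μ ε = ∫ x, Real.log (μ (Metric.ball x ε)).toReal ∂μ := rfl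
    nlinarith

theorem dim_eq_one [IsProbabilityMeasure μ] (h : IsPowerLike μ α a b) {q : ℝ} (hqα : α * q ≤ 1) :
    DmuPlus μ q = 1 ∧ DmuMinus μ q = 1 := by
  rcases lt_trichotomy q 1 with hq | rfl | hq
  · exact dim_eq_of_tendsto hq.ne (h.tendsto_dimScale_of_lt_one hq)
  · simp only [DmuPlus, DmuMinus, dimPlus, dimMinus, if_true, h.tendsto_measPFlog.limsup_eq,
      h.tendsto_measPFlog.liminf_eq, EReal.coe_one, and_self]
  · exact dim_eq_of_tendsto hq.ne' (h.tendsto_dimScale_of_le hq hqα)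

theorem dim_eq_of_ge (h : IsPowerLike μ α a b) {q : ℝ} (hqα : 1 ≤ α * q) :
    DmuPlus μ q = (((1 - α) * (q / (q - 1)) : ℝ) : EReal) ∧
      DmuMinus μ q = (((1 - α) * (q / (q - 1)) : ℝ) : EReal) := by
  have hq : 1 < q := by nlinarith [h.exponent_pos, h.exponent_lt]
  exact dim_eq_of_tendsto hq.ne' (h.tendsto_dimScale_of_ge hqα)

end IsPowerLike

lemma isPartitionSeq_gwC {p : ℝ} (hp : p < 0) : IsPartitionSeq (gwC p) where
  zero := by simp [gwC]
  anti := strictAnti_nat_of_succ_lt fun j => by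
    refine Real.rpow_lt_rpow_of_neg (by positivity) ?_ hp
    push_cast
    linarith
  lim := by
    have h := (tendsto_rpow_neg_atTop (neg_pos.2 hp)).comp
      (tendsto_atTop_add_const_right atTop (1 : ℝ) tendsto_natCast_atTop_atTop)
    rwa [neg_neg] at h

lemma isShiftMap_gwC {p : ℝ} (hp : p < 0) {T : ℝ → ℝ}
    (hT0 : ∀ x ∈ Ioo (gwC p 1) (gwC p 0), T x = (x - gwC p 1) * (1 / (gwC p 0 - gwC p 1)))
    (hTj : ∀ j : ℕ, 1 ≤ j → ∀ x ∈ Ioo (gwC p (j + 1)) (gwC p j),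
      T x = (x - gwC p (j + 1)) *
          ((gwC p (j - 1) - gwC p j) / (gwC p j - gwC p (j + 1))) + gwC p j) :
    IsShiftMap (gwC p) T where
  zero y hy := by
    have hc := isPartitionSeq_gwC hp
    have hl := (hc.len_pos 0).ne'
    rw [hT0 _ (hc.branch_mem 0 hy), branch]
    field_simp
    ring
  succ j y hy := by
    have hc := isPartitionSeq_gwC hp
    have hl := (hc.len_pos (j + 1)).ne'
    rw [hTj (j + 1) (by omega) _ (hc.branch_mem (j + 1) hy), branch, branch, Nat.add_sub_cancel]
    field_simp
    ring

/-- The density `c_j / l_j` of the invariant measure is comparable to `x ^ (1 / p)` on `I_j`. -/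
lemma gwC_div_len_bounds {p : ℝ} (hp : p < 0) {j : ℕ} {x : ℝ}
    (hx : x ∈ Ioo (gwC p (j + 1)) (gwC p j)) :
    (-(2 * p))⁻¹ * x ^ p⁻¹ ≤ gwC p j / (gwC p j - gwC p (j + 1)) ∧
      gwC p j / (gwC p j - gwC p (j + 1)) ≤ 2 ^ (1 - p) / (-p) * x ^ p⁻¹ := by
  have hn1 : (1 : ℝ) ≤ (j : ℝ) + 1 := by linarith [(Nat.cast_nonneg j : (0 : ℝ) ≤ j)]
  have hgj : gwC p j = ((j : ℝ) + 1) ^ p := rfl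
  have hgs : gwC p (j + 1) = ((j : ℝ) + 1 + 1) ^ p := by simp [gwC]
  rw [hgj, hgs] at hx ⊢
  clear hgj hgs
  generalize (j : ℝ) + 1 = n at *
  have hn0 : 0 < n := by linarith
  have hx0 : 0 < x := (Real.rpow_pos_of_pos (by linarith) p).trans hx.1
  obtain ⟨ξ, hξ, hξe⟩ := exists_hasDerivAt_eq_slope (fun y : ℝ => y ^ p)
    (fun y => p * y ^ (p - 1)) (lt_add_one n)
    (fun y hy => (Real.continuousAt_rpow_const _ _
      (Or.inl (hn0.trans_le hy.1).ne')).continuousWithinAt)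
    (fun y hy => Real.hasDerivAt_rpow_const (Or.inl (hn0.trans hy.1).ne'))
  have hξ0 : 0 < ξ := hn0.trans hξ.1
  have hinvneg : p⁻¹ < 0 := inv_lt_zero.2 hp
  have hny : n < x ^ p⁻¹ := by
    have := Real.rpow_lt_rpow_of_neg hx0 hx.2 hinvneg
    rwa [Real.rpow_rpow_inv hn0.le hp.ne] at this
  have hyn : x ^ p⁻¹ < n + 1 := by
    have := Real.rpow_lt_rpow_of_neg (by positivity) hx.1 hinvneg
    rwa [Real.rpow_rpow_inv (by positivity) hp.ne] at this
  generalize x ^ p⁻¹ = y at *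
  have hnp : 0 < n ^ p := by positivity
  have hξp : 0 < ξ ^ p := by positivity
  have h1 : 1 ≤ n ^ p / ξ ^ p :=
    (one_le_div hξp).2 (Real.rpow_le_rpow_of_nonpos hn0 hξ.1.le hp.le)
  have h2 : n ^ p / ξ ^ p ≤ 2 ^ (-p) := by
    rw [div_le_iff₀ hξp, Real.rpow_neg zero_le_two, ← div_eq_inv_mul,
      le_div_iff₀ (by positivity), mul_comm, ← Real.mul_rpow zero_le_two hn0.le]
    exact Real.rpow_le_rpow_of_nonpos hξ0 (by linarith [hξ.2]) hp.le
  have hl : n ^ p / (n ^ p - (n + 1) ^ p) = n ^ p / ξ ^ p * ξ / (-p) := by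
    have e : n ^ p - (n + 1) ^ p = -p * (ξ ^ p / ξ) := by
      rw [← Real.rpow_sub_one hξ0.ne', neg_mul, hξe, add_sub_cancel_left, div_one, neg_sub]
    rw [e]
    have := hp.ne
    field_simp
  have hp' : 0 < -p := by linarith
  rw [hl]
  generalize n ^ p / ξ ^ p = r at *
  constructor
  · rw [le_div_iff₀ hp']
    have e : (-(2 * p))⁻¹ * y * -p = y / 2 := by
      have := hp.ne
      field_simp
    rw [e]
    nlinarith [hξ.1]
  · rw [sub_eq_add_neg, Real.rpow_add zero_lt_two, Real.rpow_one, div_mul_eq_mul_div]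
    refine div_le_div_of_nonneg_right ?_ hp'.le
    calc r * ξ ≤ 2 ^ (-p) * (2 * y) :=
          mul_le_mul h2 (by linarith [hξ.2]) hξ0.le (by positivity)
      _ = _ := by ring

namespace IsShiftMap

variable {p : ℝ} {T : ℝ → ℝ} {μ : Measure ℝ}

/-- The invariant measure of the Gaspard–Wang map is comparable to `x ^ (1 / p) dx`. -/
lemma exists_isPowerLike (hp : p < -1) (hT : IsShiftMap (gwC p) T) [IsFiniteMeasure μ]
    (hac : μ ≪ volume) (hμ : ∀ᵐ x ∂μ, x ∈ Ioo (0 : ℝ) 1) (hinv : MeasurePreserving T μ μ)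
    (h0 : μ ≠ 0) : ∃ a b, IsPowerLike μ (-p⁻¹) a b := by
  have hp0 : p < 0 := by linarith
  have hc := isPartitionSeq_gwC hp0
  have hκ0 := measure_first_interval_ne_zero hc hT hac hμ hinv h0
  have hκ := ENNReal.toReal_pos hκ0 (measure_ne_top _ _)
  have hdens := fun i E hE hE' =>
    measure_of_subset_interval hc hT hac hμ hinv i (E := E) hE hE'
  rw [← ENNReal.ofReal_toReal (measure_ne_top μ (Ioo (gwC p 1) (gwC p 0)))] at hdens
  generalize (μ (Ioo (gwC p 1) (gwC p 0))).toReal = κ at hκ hdens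
  have hpow : ∀ᵐ x ∂powMeasure (-p⁻¹), x ∈ Ioo (0 : ℝ) 1 :=
    (withDensity_absolutelyContinuous _ _).ae_le (ae_restrict_mem measurableSet_Ioo)
  have hpowac : powMeasure (-p⁻¹) ≪ volume :=
    (withDensity_absolutelyContinuous _ _).trans Measure.absolutelyContinuous_restrict
  have hp2 : 0 < -(2 * p) := by linarith
  have hp' : 0 < -p := by linarith
  have hd : ∀ i (E : Set ℝ), MeasurableSet E → E ⊆ Ioo (gwC p (i + 1)) (gwC p i) →
      μ E = ∫⁻ _ in E, ENNReal.ofReal (κ * (gwC p i / (gwC p i - gwC p (i + 1)))) := by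
    intro i E hE hE'
    rw [hdens i E hE hE', setLIntegral_const, ENNReal.ofReal_mul hκ.le]
  have hw : ∀ i (E : Set ℝ) (r : ℝ), 0 ≤ r → MeasurableSet E →
      E ⊆ Ioo (gwC p (i + 1)) (gwC p i) →
      ENNReal.ofReal r * powMeasure (-p⁻¹) E = ∫⁻ x in E, ENNReal.ofReal (r * x ^ p⁻¹) := by
    intro i E r hr hE hE'
    rw [powMeasure_apply _ hE, inter_eq_left.2 (hE'.trans (hc.interval_subset i)), neg_neg,
      ← lintegral_const_mul _ (measurable_ofReal_rpow _)]
    simp_rw [ENNReal.ofReal_mul hr]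
  refine ⟨κ * (-(2 * p))⁻¹, κ * (2 ^ (1 - p) / (-p)), ?_, ?_, by positivity, by positivity,
    Measure.le_iff.2 fun E hE => ?_, Measure.le_iff.2 fun E hE => ?_⟩
  · exact neg_pos.2 (inv_lt_zero.2 hp0)
  · rw [← inv_neg]
    exact inv_lt_one_of_one_lt₀ (by linarith)
  all_goals
    rw [Measure.smul_apply, smul_eq_mul, measure_eq_tsum hc hac hμ hE,
      measure_eq_tsum hc hpowac hpow hE, ← ENNReal.tsum_mul_left]
    refine ENNReal.tsum_le_tsum fun i => ?_
    have hEi := hE.inter (measurableSet_Ioo (a := gwC p (i + 1)) (b := gwC p i))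
    rw [hd i _ hEi inter_subset_right, hw i _ _ (by positivity) hEi inter_subset_right]
    refine setLIntegral_mono' hEi fun x hx => ENNReal.ofReal_le_ofReal ?_
    rw [mul_assoc]
    gcongr
  · exact (gwC_div_len_bounds hp0 hx.2).1
  · exact (gwC_div_len_bounds hp0 hx.2).2

end IsShiftMap

lemma le_firstReturn {T : ℝ → ℝ} {A : Set ℝ} {x : ℝ} {J : ℕ}
    (hrec : ∃ n, 0 < n ∧ T^[n] x ∈ A) (h : ∀ k, 0 < k → k < J → T^[k] x ∉ A) :
    J ≤ firstReturn T A x :=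
  le_csInf hrec fun k hk => not_lt.1 fun hkJ => h k hk.1 hkJ hk.2

namespace IsShiftMap

variable {c : ℕ → ℝ} {T : ℝ → ℝ} {μ : Measure ℝ}

lemma iterate_mem (hc : IsPartitionSeq c) (hT : IsShiftMap c T) {k j : ℕ} {y : ℝ}
    (hy : y ∈ Ioo (c (j + k + 1)) (c (j + k))) : T^[k] y ∈ Ioo (c (j + 1)) (c j) := by
  induction k generalizing y with
  | zero => exact hy
  | succ k ih =>
    rw [Function.iterate_succ_apply]
    refine ih ?_
    obtain ⟨z, hz, rfl⟩ := hc.exists_branch_eq _ hy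
    rw [← add_assoc, hT.succ _ z hz]
    exact hc.branch_mem _ hz

lemma le_firstReturn_ball (hc : IsPartitionSeq c) (hT : IsShiftMap c T) {ε x y : ℝ} {J j : ℕ}
    (hε : ε ≤ c 1 - c 2) (hx : branch c 0 y = x) (hj : J ≤ j)
    (hy : y ∈ Ioo (c (j + 1)) (c j)) (hrec : ∃ n, 0 < n ∧ T^[n] x ∈ Metric.ball x ε) :
    J ≤ firstReturn T (Metric.ball x ε) x := by
  refine le_firstReturn hrec fun k hk hkJ hmem => ?_
  have hy01 := hc.interval_subset j hy
  have hx1 := (hc.branch_mem 0 hy01).1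
  obtain ⟨k, rfl⟩ := Nat.exists_eq_add_of_lt hk
  rw [zero_add, Function.iterate_succ_apply, ← hx, hT.zero y hy01, hx] at hmem
  rw [hx] at hx1
  have hmem' := iterate_mem hc hT (k := k) (j := j - k) (y := y)
    (by rwa [Nat.sub_add_cancel (by omega)])
  rw [Real.ball_eq_Ioo] at hmem
  have : c (j - k) ≤ c 2 := hc.anti.antitone (by omega)
  have := hmem'.2
  have := hmem.1
  rw [zero_add] at hx1
  linarith

lemma le_retPF (hc : IsPartitionSeq c) (hT : IsShiftMap c T)
    (hac : μ ≪ volume) (hμ : ∀ᵐ x ∂μ, x ∈ Ioo (0 : ℝ) 1) (hinv : MeasurePreserving T μ μ)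
    [IsFiniteMeasure μ] {ε q : ℝ} (hq : q ≤ 1) (hε0 : 0 < ε) (hε : ε ≤ c 1 - c 2)
    (J : ℕ) :
    (J : ℝ≥0∞) ^ (1 - q) * (μ (Ioo (c 1) (c 0)) * ENNReal.ofReal (c J)) ≤ retPF T μ ε q := by
  have hsub : Ioo 0 (c J) ⊆ Ioo (0 : ℝ) 1 := Ioo_subset_Ioo_right (hc.le_one J)
  have hm := (hc.measurableEmbedding_branch 0).measurableSet_image'
    (measurableSet_Ioo (a := (0 : ℝ)) (b := c J))
  have hmeas := measure_image_zero hc hT hac hμ hinv (measurableSet_Ioo (a := 0) (b := c J)) hsub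
  rw [Real.volume_Ioo, sub_zero] at hmeas
  rw [← hmeas, ← setLIntegral_const]
  refine (setLIntegral_mono_ae' hm ?_).trans (setLIntegral_le_lintegral _ _)
  have hbad : μ (branch c 0 '' range c) = 0 :=
    hac (((countable_range c).image _).measure_zero volume)
  filter_upwards [hinv.conservative.ae_frequently_mem_of_mem_nhds,
    compl_mem_ae_iff.2 hbad] with x hrec hxr hx
  refine ENNReal.rpow_le_rpow (Nat.cast_le.2 ?_) (by linarith)
  obtain ⟨y, hy, hyx⟩ := hx
  obtain ⟨j, hj⟩ := hc.exists_mem (hsub hy) fun h => hxr ⟨y, h, hyx⟩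
  refine le_firstReturn_ball hc hT hε hyx ?_ hj ?_
  · exact not_lt.1 fun h => (hj.1.trans hy.2).not_ge (hc.anti.antitone h)
  · obtain ⟨n, hn, hn'⟩ := (frequently_atTop.1 (hrec _ (Metric.ball_mem_nhds x hε0))) 1
    exact ⟨n, hn, hn'⟩

end IsShiftMap

lemma IsShiftMap.retPF_eq_top {p : ℝ} {T : ℝ → ℝ} {μ : Measure ℝ} [IsFiniteMeasure μ]
    (hp : p < 0) (hT : IsShiftMap (gwC p) T) (hac : μ ≪ volume)
    (hμ : ∀ᵐ x ∂μ, x ∈ Ioo (0 : ℝ) 1) (hinv : MeasurePreserving T μ μ) (h0 : μ ≠ 0)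
    {ε q : ℝ} (hq : q < p + 1) (hε0 : 0 < ε) (hε : ε ≤ gwC p 1 - gwC p 2) :
    retPF T μ ε q = ⊤ := by
  have hc := isPartitionSeq_gwC hp
  have hκ0 := hT.measure_first_interval_ne_zero hc hac hμ hinv h0
  have hlim : Tendsto (fun J : ℕ => ENNReal.ofReal (2 ^ p * (J : ℝ) ^ (1 - q + p))) atTop
      (𝓝 ⊤) :=
    ENNReal.tendsto_ofReal_nhds_top.2 (((tendsto_rpow_atTop (by linarith)).comp
      tendsto_natCast_atTop_atTop).const_mul_atTop (by positivity))
  have hlim' := ENNReal.Tendsto.const_mul (a := μ (Ioo (gwC p 1) (gwC p 0))) hlim (Or.inl (by simp))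
  rw [ENNReal.mul_top hκ0] at hlim'
  refine top_le_iff.1 (le_of_tendsto hlim' ?_)
  filter_upwards [eventually_ge_atTop 1] with J hJ
  refine le_trans ?_ (le_retPF hc hT hac hμ hinv (by linarith) hε0 hε J)
  have hJ1 : (1 : ℝ) ≤ J := by exact_mod_cast hJ
  have hJ0 : (0 : ℝ) < J := by linarith
  rw [mul_left_comm, ← ENNReal.ofReal_natCast, ENNReal.ofReal_rpow_of_pos hJ0,
    ← ENNReal.ofReal_mul (by positivity), gwC]
  refine mul_le_mul_right (ENNReal.ofReal_le_ofReal ?_) _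
  rw [Real.rpow_add hJ0, mul_left_comm, ← Real.mul_rpow zero_le_two hJ0.le]
  gcongr ?_ * ?_
  exact Real.rpow_le_rpow_of_nonpos (by linarith) (by linarith) hp.le

lemma dim_eq_top {F : ℝ → ℝ≥0∞} {Flog : ℝ → ℝ} {q r : ℝ} (hq : q < 1) (hr : 0 < r)
    (h : ∀ ε, 0 < ε → ε ≤ r → F ε = ⊤) : dimPlus F Flog q = ⊤ ∧ dimMinus F Flog q = ⊤ := by
  refine dim_eq_of_tendsto hq.ne (tendsto_const_nhds.congr' ?_)
  filter_upwards [Ioo_mem_nhdsGT (lt_min hr one_pos)] with ε hε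
  have hlog : Real.log ε < 0 := Real.log_neg hε.1 (hε.2.trans_le (min_le_right _ _))
  rw [dimScale, h ε hε.1 (hε.2.le.trans (min_le_left _ _)), elog, if_neg ENNReal.top_ne_zero,
    if_pos rfl, EReal.coe_mul_top_of_pos]
  exact inv_pos.2 (mul_pos_of_neg_of_neg (by linarith) hlog)

/-- For the Gaspard–Wang map with parameter `p < -1` and its unique
absolutely continuous invariant probability measure `μ`: `D_τ^±(q) = +∞` for all
`q < q_c := p + 1`, while `D_μ^±(q) = 1` for `q ≤ -p` and
`D_μ^±(q) = (1 + 1/p)·q/(q-1)` for `q ≥ -p`. -/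
theorem gaspard_wang_dimensions (p : ℝ) (hp : p < -1) (T : ℝ → ℝ)
    (hTmeas : Measurable T)
    (hT0 : ∀ x ∈ Set.Ioo (gwC p 1) (gwC p 0),
      T x = (x - gwC p 1) * (1 / (gwC p 0 - gwC p 1)))
    (hTj : ∀ j : ℕ, 1 ≤ j → ∀ x ∈ Set.Ioo (gwC p (j + 1)) (gwC p j),
      T x = (x - gwC p (j + 1)) *
          ((gwC p (j - 1) - gwC p j) / (gwC p j - gwC p (j + 1))) + gwC p j)
    (μ : Measure ℝ) [IsProbabilityMeasure μ] (hsupp : μ (Set.Icc (0:ℝ) 1) = 1)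
    (hac : μ ≪ volume) (hinv : MeasureTheory.MeasurePreserving T μ μ) :
    (∀ q : ℝ, q < p + 1 →
      DtauPlus T μ q = (⊤ : EReal) ∧ DtauMinus T μ q = (⊤ : EReal)) ∧
    (∀ q : ℝ, q ≤ -p → DmuPlus μ q = (1 : EReal) ∧ DmuMinus μ q = (1 : EReal)) ∧
    (∀ q : ℝ, -p ≤ q →
      DmuPlus μ q = (((1 + 1 / p) * (q / (q - 1)) : ℝ) : EReal) ∧
        DmuMinus μ q = (((1 + 1 / p) * (q / (q - 1)) : ℝ) : EReal)) := by
  have hp0 : p < 0 := by linarith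
  have hT := isShiftMap_gwC hp0 hT0 hTj
  have hc := isPartitionSeq_gwC hp0
  have hμ : ∀ᵐ x ∂μ, x ∈ Ioo (0 : ℝ) 1 := by
    have hIcc : ∀ᵐ x ∂μ, x ∈ Icc (0 : ℝ) 1 := mem_ae_iff_prob_eq_one measurableSet_Icc |>.2 hsupp
    filter_upwards [hIcc, hac.ae_le (compl_mem_ae_iff.2 (measure_singleton 0)),
      hac.ae_le (compl_mem_ae_iff.2 (measure_singleton 1))] with x hx hx0 hx1
    exact ⟨hx.1.lt_of_ne' hx0, hx.2.lt_of_ne hx1⟩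
  obtain ⟨a, b, hpow⟩ := hT.exists_isPowerLike hp hac hμ hinv (IsProbabilityMeasure.ne_zero μ)
  refine ⟨fun q hq => ?_, fun q hq => hpow.dim_eq_one ?_, fun q hq => ?_⟩
  · exact dim_eq_top (by linarith) (hc.len_pos 1) fun ε hε0 hε =>
      hT.retPF_eq_top hp0 hac hμ hinv (IsProbabilityMeasure.ne_zero μ) hq hε0 hε
  · rw [← inv_neg, inv_mul_le_iff₀ (by linarith), mul_one]
    exact hq
  · rw [show 1 + 1 / p = 1 - -p⁻¹ by rw [one_div, sub_neg_eq_add]]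
    refine hpow.dim_eq_of_ge ?_
    rw [← inv_neg, le_inv_mul_iff₀ (by linarith), mul_one]
    exact hq
end
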